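/- Let $(M,g)$ be a real smooth 4-dimensional Lorentzian manifold of signature $(+,-,-,-)$ with a spinor structure: a complex rank-2 spinor bundle $\mathbb S$ with symplectic form $\epsilon_{AB}$, complex conjugate bundle $\mathbb S'$, and $TM\otimes\mathbb C\cong\mathbb S\otimes\mathbb S'$ with $g_{ab}=\epsilon_{AB}\bar\epsilon_{A'B'}$; let $\nabla_{AA'}$ be the spinor covariant derivative induced by the Levi-Civita connection, and $\Psi_{ABCD}=\Psi_{(ABCD)}$ the (anti-self-dual) Weyl spinor, i.e. the totally symmetric part of $\tfrac14\bar\epsilon^{A'B'}\bar\epsilon^{C'D'}R_{AA'BB'CC'DD'}$. Assume that $g$ is Einstein: the trace-free part of the Ricci tensor vanishes and $\Lambda=R/24$ is constant. Let $(o^A,\iota^A)$ be a smooth spin dyad on $M$, $o_A\iota^A=1$, and put $\Psi_2=\Psi_{ABCD}o^Ao^B\iota^C\iota^D$, $\Psi_3=\Psi_{ABCD}o^A\iota^B\iota^C\iota^D$. Assume that $(M,g)$ is of Petrov type II with repeated principal spinor $o^A$, in the sense that $\Psi_{ABCD}o^Bo^Co^D=0$ and $\Psi_2\neq0$ everywhere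 on $M$, and let $\Psi_2^{1/3}$ be a smooth cube root of $\Psi_2$ on $M$. Let $$K_{AB}=\Psi_2^{-1/3}\,o_{(A}\iota_{B)}-\tfrac13\,\Psi_2^{-4/3}\,\Psi_3\,o_Ao_B$$ be the projected Killing spinor. Then $\varphi_{AB}=\Psi_{ABCD}K^{CD}$ is a smooth symmetric spinor field, it equals $-2\Psi_2K_{AB}$, and it solves the source-free Maxwell equations $$\nabla^{AA'}\varphi_{AB}=0 .$$ -/

import Mathlib

open scoped Manifold ContDiff

noncomputable section

namespace SpinGeometry

/-- The model space of a real 4-manifold. -/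
abbrev E4 : Type := EuclideanSpace ℝ (Fin 4)

/-- The Minkowski matrix `diag(1, -1, -1, -1)` (equal to its own inverse). -/
def eta (a b : Fin 4) : ℝ := if a = b then (if a = 0 then 1 else -1) else 0

/-- A smooth Lorentzian metric of signature `(+,-,-,-)` on a smooth 4-manifold. -/
structure LorentzMetric (M : Type*) [TopologicalSpace M] [ChartedSpace E4 M]
    [IsManifold (𝓡 4) ∞ M] where
  /-- the bilinear form `g_x` on the tangent space at `x` -/
  val : ∀ x : M, TangentSpace (𝓡 4) x →L[ℝ] TangentSpace (𝓡 4) x →L[ℝ] ℝ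
  symm : ∀ x v w, val x v w = val x w v
  signature : ∀ x, ∃ b : Module.Basis (Fin 4) ℝ (TangentSpace (𝓡 4) x),
    ∀ i j, val x (b i) (b j) = eta i j
  contMDiff : ContMDiff (𝓡 4) ((𝓡 4).prod 𝓘(ℝ, E4 →L[ℝ] E4 →L[ℝ] ℝ)) ∞
    (fun x ↦ Bundle.TotalSpace.mk' (E4 →L[ℝ] E4 →L[ℝ] ℝ)
      (E := fun x : M ↦ TangentSpace (𝓡 4) x →L[ℝ] TangentSpace (𝓡 4) x →L[ℝ] ℝ) x (val x))

/-- A trivialised spinor structure on `(M, g)`, given by a smooth global orthonormal tetrad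
`E₀, …, E₃`. The spinor bundle is `𝕊 = M × ℂ²` with the standard symplectic form `ε` (`ε₀₁ = 1`),
`𝕊'` is its complex conjugate, and `TM ⊗ ℂ ≅ 𝕊 ⊗ 𝕊'` is the isomorphism that carries the basis
element with indices `A A'` to `e_{AA'} = ∑ₐ s^a_{AA'} Eₐ` (see `solder`), so that
`g(e_{AA'}, e_{BB'}) = ε_{AB} ε_{A'B'}`. As a spin dyad trivialises the spinor bundle, every
spinor structure with a spin dyad is isomorphic to one of this form. -/
structure SpinFrame {M : Type*} [TopologicalSpace M] [ChartedSpace E4 M]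
    [IsManifold (𝓡 4) ∞ M] (g : LorentzMetric M) where
  /-- the tetrad vector field `Eₐ` -/
  vec : Fin 4 → ∀ x : M, TangentSpace (𝓡 4) x
  contMDiff : ∀ a, ContMDiff (𝓡 4) ((𝓡 4).prod 𝓘(ℝ, E4)) ∞
    (fun x ↦ (⟨x, vec a x⟩ : TangentBundle (𝓡 4) M))
  orthonormal : ∀ x a b, g.val x (vec a x) (vec b x) = eta a b

/-- The symplectic form of spin space, `ε_{01} = 1 = -ε_{10}`; the inverse `ε^{AB}` and the primed
forms have the same components. Indices are moved by `ψ_B = ψ^A ε_{AB}`, `ψ^A = ε^{AB} ψ_B`. -/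
def eps (A B : Fin 2) : ℂ := (!![0, 1; -1, 0] : Matrix (Fin 2) (Fin 2) ℂ) A B

/-- The identity and the three Pauli matrices. -/
def pauli : Fin 4 → Matrix (Fin 2) (Fin 2) ℂ :=
  ![!![1, 0; 0, 1], !![0, 1; 1, 0], !![0, -Complex.I; Complex.I, 0], !![1, 0; 0, -1]]

/-- The Infeld–van der Waerden symbols `s^a_{AA'}`: `e_{AA'} = ∑ₐ s^a_{AA'} Eₐ`. -/
def solder (a : Fin 4) (A A' : Fin 2) : ℂ := ((Real.sqrt 2 : ℝ) : ℂ)⁻¹ * pauli a A A'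

/-- `ψ_A = ψ^B ε_{BA}`. -/
def lower (ψ : Fin 2 → ℂ) (A : Fin 2) : ℂ := ∑ B, ψ B * eps B A

/-- `K^{CD} = ε^{CA} ε^{DB} K_{AB}`. -/
def raise₂ (K : Fin 2 → Fin 2 → ℂ) (C D : Fin 2) : ℂ := ∑ A, ∑ B, eps C A * eps D B * K A B

namespace SpinFrame

variable {M : Type*} [TopologicalSpace M] [ChartedSpace E4 M] [IsManifold (𝓡 4) ∞ M]
  {g : LorentzMetric M} (F : SpinFrame g)

/-- The derivative `Eₐ(f)` of a real function. -/
def dR (a : Fin 4) (f : M → ℝ) (x : M) : ℝ :=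
  mfderiv (𝓡 4) 𝓘(ℝ, ℝ) f x (F.vec a x)

/-- The derivative `Eₐ(f)` of a complex function. -/
def dC (a : Fin 4) (f : M → ℂ) (x : M) : ℂ :=
  mfderiv (𝓡 4) 𝓘(ℝ, ℂ) f x (F.vec a x)

/-- `g([Eₐ, E_b], E_c)`. -/
def bracket (a b c : Fin 4) (x : M) : ℝ :=
  g.val x (VectorField.mlieBracket (𝓡 4) (F.vec a) (F.vec b) x) (F.vec c x)

/-- The Levi-Civita connection in the tetrad, `ω_{abc} = g(∇_{Eₐ} E_b, E_c)`, by the Koszul formula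
(the terms that differentiate the constants `g(E_b, E_c)` vanish). -/
def conn (a b c : Fin 4) (x : M) : ℝ :=
  (F.bracket a b c x - F.bracket b c a x + F.bracket c a b x) / 2

/-- `ω_{ab}{}^c`, i.e. `∇_{Eₐ} E_b = ∑_c ω_{ab}{}^c E_c`. -/
def connUp (a b c : Fin 4) (x : M) : ℝ := ∑ d, F.conn a b d x * eta d c

/-- `[Eₐ, E_b] = ∑_c C_{ab}{}^c E_c`. -/
def bracketUp (a b c : Fin 4) (x : M) : ℝ := ∑ d, F.bracket a b d x * eta d c

/-- `R_{abc}{}^d`, the components of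
`(∇_{Eₐ} ∇_{E_b} - ∇_{E_b} ∇_{Eₐ} - ∇_{[Eₐ, E_b]}) E_c = ∑_d R_{abc}{}^d E_d`. -/
def riemannUp (a b c d : Fin 4) (x : M) : ℝ :=
  F.dR a (F.connUp b c d) x - F.dR b (F.connUp a c d) x
    + ∑ e, (F.connUp b c e x * F.connUp a e d x - F.connUp a c e x * F.connUp b e d x
      - F.bracketUp a b e x * F.connUp e c d x)

/-- The Riemann tensor `R_{abcd}`. -/
def riemann (a b c d : Fin 4) (x : M) : ℝ := ∑ e, F.riemannUp a b c e x * eta e d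

/-- The Ricci tensor `R_{ab} = R_{acb}{}^c`. -/
def ricci (a b : Fin 4) (x : M) : ℝ := ∑ c, F.riemannUp a c b c x

/-- The scalar curvature `R = R_a{}^a`. -/
def scalarCurvature (x : M) : ℝ := ∑ a, ∑ b, eta a b * F.ricci a b x

/-- Einstein spacetime: the trace-free part of the Ricci tensor vanishes and `Λ = R/24` is
constant. -/
def IsEinstein : Prop :=
  (∀ x a b, F.ricci a b x - F.scalarCurvature x / 4 * eta a b = 0) ∧
    ∃ Λ : ℝ, ∀ x, F.scalarCurvature x / 24 = Λ

/-- `R_{AA'BB'CC'DD'}`. -/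
def riemannSpinor (A A' B B' C C' D D' : Fin 2) (x : M) : ℂ :=
  ∑ a, ∑ b, ∑ c, ∑ d, solder a A A' * solder b B B' * solder c C C' * solder d D D'
    * (F.riemann a b c d x : ℂ)

/-- `X_{ABCD} = ¼ ε^{A'B'} ε^{C'D'} R_{AA'BB'CC'DD'}`. -/
def curvatureSpinor (A B C D : Fin 2) (x : M) : ℂ :=
  (1 / 4 : ℂ) * ∑ A', ∑ B', ∑ C', ∑ D', eps A' B' * eps C' D'
    * F.riemannSpinor A A' B B' C C' D D' x

/-- The (anti-self-dual) Weyl spinor `Ψ_{ABCD} = X_{(ABCD)}`. -/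
def weyl (A B C D : Fin 2) (x : M) : ℂ :=
  (1 / 24 : ℂ) * ∑ π : Equiv.Perm (Fin 4),
    F.curvatureSpinor (![A, B, C, D] (π 0)) (![A, B, C, D] (π 1)) (![A, B, C, D] (π 2))
      (![A, B, C, D] (π 3)) x

/-- `Γ_{aBC} = ½ ε^{B'C'} g(∇_{Eₐ} e_{BB'}, e_{CC'})`, the unprimed part of the Levi-Civita
connection. -/
def spinConn (a : Fin 4) (B C : Fin 2) (x : M) : ℂ :=
  (1 / 2 : ℂ) * ∑ B', ∑ C', eps B' C' *
    ∑ b, ∑ c, solder b B B' * solder c C C' * (F.conn a b c x : ℂ)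

/-- `Γ_{aB}{}^D = ε^{DC} Γ_{aBC}`: the spin connection, that is, the connection on `𝕊` that
preserves `ε` and induces the Levi-Civita connection,
`∇_{Eₐ} e_{BB'} = Γ_{aB}{}^D e_{DB'} + conj(Γ_{aB'}{}^{D'}) e_{BD'}`. -/
def spinConnUp (a : Fin 4) (B D : Fin 2) (x : M) : ℂ := ∑ C, eps D C * F.spinConn a B C x

/-- `∇_a φ_{BC}` for the tetrad index `a`. -/
def nabla₂ (φ : M → Fin 2 → Fin 2 → ℂ) (a : Fin 4) (B C : Fin 2) (x : M) : ℂ :=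
  F.dC a (fun y ↦ φ y B C) x
    - ∑ D, F.spinConnUp a B D x * φ x D C - ∑ D, F.spinConnUp a C D x * φ x B D

/-- `∇_{AA'} φ_{BC}`. -/
def spinNabla₂ (φ : M → Fin 2 → Fin 2 → ℂ) (A A' B C : Fin 2) (x : M) : ℂ :=
  ∑ a, solder a A A' * F.nabla₂ φ a B C x

/-- `∇^{AA'} φ_{AB} = ε^{AC} ε^{A'C'} ∇_{CC'} φ_{AB}`. -/
def divergence (φ : M → Fin 2 → Fin 2 → ℂ) (A' B : Fin 2) (x : M) : ℂ :=
  ∑ A, ∑ C, ∑ C', eps A C * eps A' C' * F.spinNabla₂ φ C C' A B x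

/-- The source-free Maxwell equations `∇^{AA'} φ_{AB} = 0` for a smooth symmetric spinor. -/
def IsMaxwellField (φ : M → Fin 2 → Fin 2 → ℂ) : Prop :=
  ContMDiff (𝓡 4) 𝓘(ℝ, Fin 2 → Fin 2 → ℂ) ∞ φ ∧ (∀ x A B, φ x A B = φ x B A) ∧
    ∀ x A' B, F.divergence φ A' B x = 0

/-- `Ψ₂ = Ψ_{ABCD} o^A o^B ι^C ι^D`. -/
def Psi2 (o ι : M → Fin 2 → ℂ) (x : M) : ℂ :=
  ∑ A, ∑ B, ∑ C, ∑ D, F.weyl A B C D x * o x A * o x B * ι x C * ι x D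

/-- `Ψ₃ = Ψ_{ABCD} o^A ι^B ι^C ι^D`. -/
def Psi3 (o ι : M → Fin 2 → ℂ) (x : M) : ℂ :=
  ∑ A, ∑ B, ∑ C, ∑ D, F.weyl A B C D x * o x A * ι x B * ι x C * ι x D

/-- The spacetime has Petrov type II with repeated principal spinor `o`, in the spin dyad `(o, ι)`:
`Ψ_{ABCD} o^B o^C o^D = 0` (equivalently `Ψ₀ = Ψ₁ = 0`) and `Ψ₂ ≠ 0`. -/
def IsPetrovTypeII (o ι : M → Fin 2 → ℂ) : Prop :=
  (∀ x A, ∑ B, ∑ C, ∑ D, F.weyl A B C D x * o x B * o x C * o x D = 0) ∧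
    ∀ x, F.Psi2 o ι x ≠ 0

/-- The projected Killing spinor
`K_{AB} = Ψ₂^{-1/3} o_{(A} ι_{B)} - ⅓ Ψ₂^{-4/3} Ψ₃ o_A o_B`, where `p` stands for `Ψ₂^{1/3}`. -/
def projectedKillingSpinor (o ι : M → Fin 2 → ℂ) (p : M → ℂ) (x : M) (A B : Fin 2) : ℂ :=
  (p x)⁻¹ * ((lower (o x) A * lower (ι x) B + lower (o x) B * lower (ι x) A) / 2)
    - (1 / 3 : ℂ) * ((p x) ^ 4)⁻¹ * F.Psi3 o ι x * lower (o x) A * lower (o x) B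

/-- `Ψ_{ABCD} K^{CD}`. -/
def spinLowering (K : M → Fin 2 → Fin 2 → ℂ) (x : M) (A B : Fin 2) : ℂ :=
  ∑ C, ∑ D, F.weyl A B C D x * raise₂ (K x) C D

end SpinFrame

/-- A smooth spin dyad `(o^A, ι^A)`, normalised by `o_A ι^A = 1`. -/
def IsSpinDyad {M : Type*} [TopologicalSpace M] [ChartedSpace E4 M]
    (o ι : M → Fin 2 → ℂ) : Prop :=
  ContMDiff (𝓡 4) 𝓘(ℝ, Fin 2 → ℂ) ∞ o ∧ ContMDiff (𝓡 4) 𝓘(ℝ, Fin 2 → ℂ) ∞ ι ∧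
    ∀ x, ∑ A, lower (o x) A * ι x A = 1

end SpinGeometry

end

open scoped Manifold ContDiff

noncomputable section

namespace SpinGeometry

open VectorField

lemma two_le_infty : (2 : ℕ∞ω) ≤ ∞ :=
  WithTop.coe_le_coe.2 (le_top : (2 : ℕ∞) ≤ ⊤)

lemma three_le_infty : (3 : ℕ∞ω) ≤ ∞ :=
  WithTop.coe_le_coe.2 (le_top : (3 : ℕ∞) ≤ ⊤)

lemma eta_self_mul_self (a : Fin 4) : eta a a * eta a a = 1 := by
  fin_cases a <;> norm_num [eta]

lemma eta_of_ne {a b : Fin 4} (h : a ≠ b) : eta a b = 0 := by simp [eta, h]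

namespace SpinFrame

variable {M : Type*} [TopologicalSpace M] [ChartedSpace E4 M] [IsManifold (𝓡 4) ∞ M]
  {g : LorentzMetric M} (F : SpinFrame g)

/-! ### The tetrad as a basis -/

lemma metric_sum_smul_vec (x : M) (c : Fin 4 → ℝ) (b : Fin 4) :
    g.val x (∑ a, c a • F.vec a x) (F.vec b x) = c b * eta b b := by
  rw [map_sum, sum_apply, Finset.sum_eq_single b]
  · simp [F.orthonormal]
  · intro a _ hab
    simp [F.orthonormal, eta_of_ne hab]
  · simp

lemma linearIndependent_vec (x : M) : LinearIndependent ℝ (fun a ↦ F.vec a x) := by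
  rw [Fintype.linearIndependent_iff]
  intro c hc b
  have h := F.metric_sum_smul_vec x c b
  rw [hc, map_zero, zero_apply] at h
  have h2 := congrArg (· * eta b b) h
  simp only [zero_mul, mul_assoc, eta_self_mul_self, mul_one] at h2
  exact h2.symm

lemma span_vec (x : M) : ⊤ ≤ Submodule.span ℝ (Set.range fun a ↦ F.vec a x) := by
  have : FiniteDimensional ℝ (TangentSpace (𝓡 4) x) :=
    inferInstanceAs (FiniteDimensional ℝ E4)
  refine ((F.linearIndependent_vec x).span_eq_top_of_card_eq_finrank ?_).ge
  change Fintype.card (Fin 4) = Module.finrank ℝ E4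
  simp

/-- Expansion of a tangent vector in the tetrad. -/
lemma expand (x : M) (v : TangentSpace (𝓡 4) x) :
    v = ∑ a, (g.val x v (F.vec a x) * eta a a) • F.vec a x := by
  obtain ⟨c, hc⟩ := (Submodule.mem_span_range_iff_exists_fun ℝ).1 (F.span_vec x (Submodule.mem_top (x := v)))
  have h : ∀ a, g.val x v (F.vec a x) * eta a a = c a := fun a ↦ by
    rw [← hc, F.metric_sum_smul_vec, mul_assoc, eta_self_mul_self, mul_one]
  simp_rw [h, hc]

/-! ### Derivatives along the tetrad -/

lemma dR_eq (a : Fin 4) (f : M → ℝ) (x : M) : F.dR a f x = mvfderiv (𝓡 4) f x (F.vec a x) := rfl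

lemma dC_eq (a : Fin 4) (f : M → ℂ) (x : M) : F.dC a f x = mvfderiv (𝓡 4) f x (F.vec a x) := rfl

lemma dC_add (a : Fin 4) {f h : M → ℂ} {x : M} (hf : MDifferentiableAt (𝓡 4) 𝓘(ℝ, ℂ) f x)
    (hh : MDifferentiableAt (𝓡 4) 𝓘(ℝ, ℂ) h x) :
    F.dC a (fun y ↦ f y + h y) x = F.dC a f x + F.dC a h x := by
  have := congrArg (fun T ↦ T (F.vec a x)) (hf.hasMFDerivAt.add hh.hasMFDerivAt).mfderiv
  exact this

lemma dC_sub (a : Fin 4) {f h : M → ℂ} {x : M} (hf : MDifferentiableAt (𝓡 4) 𝓘(ℝ, ℂ) f x)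
    (hh : MDifferentiableAt (𝓡 4) 𝓘(ℝ, ℂ) h x) :
    F.dC a (fun y ↦ f y - h y) x = F.dC a f x - F.dC a h x := by
  have := congrArg (fun T ↦ T (F.vec a x)) (hf.hasMFDerivAt.sub hh.hasMFDerivAt).mfderiv
  exact this

lemma dC_mul (a : Fin 4) {f h : M → ℂ} {x : M} (hf : MDifferentiableAt (𝓡 4) 𝓘(ℝ, ℂ) f x)
    (hh : MDifferentiableAt (𝓡 4) 𝓘(ℝ, ℂ) h x) :
    F.dC a (fun y ↦ f y * h y) x = f x * F.dC a h x + h x * F.dC a f x := by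
  have := congrArg (fun T ↦ T (F.vec a x)) (hf.hasMFDerivAt.mul hh.hasMFDerivAt).mfderiv
  exact this

lemma dC_const (a : Fin 4) (c : ℂ) (x : M) : F.dC a (fun _ ↦ c) x = 0 := by
  rw [dC_eq, mvfderiv_const]; rfl

lemma dC_const_mul (a : Fin 4) (c : ℂ) {f : M → ℂ} {x : M}
    (hf : MDifferentiableAt (𝓡 4) 𝓘(ℝ, ℂ) f x) :
    F.dC a (fun y ↦ c * f y) x = c * F.dC a f x := by
  rw [F.dC_mul a mdifferentiableAt_const hf, dC_const, mul_zero, add_zero]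

lemma dC_ofReal (a : Fin 4) {f : M → ℝ} {x : M} (hf : MDifferentiableAt (𝓡 4) 𝓘(ℝ, ℝ) f x) :
    F.dC a (fun y ↦ (f y : ℂ)) x = (F.dR a f x : ℂ) := by
  have h := (Complex.ofRealCLM.hasMFDerivAt (x := f x)).comp x hf.hasMFDerivAt
  have := congrArg (fun T ↦ T (F.vec a x)) h.mfderiv
  exact this

lemma dR_eq_bracket (V : ∀ x : M, TangentSpace (𝓡 4) x) {f : M → ℝ} {x : M}
    (hf : MDifferentiableAt (𝓡 4) 𝓘(ℝ, ℝ) f x) :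
    mvfderiv (𝓡 4) f x (V x) = g.val x (mlieBracket (𝓡 4) V (f • F.vec 0) x) (F.vec 0 x)
      - f x * g.val x (mlieBracket (𝓡 4) V (F.vec 0) x) (F.vec 0 x) := by
  rw [mlieBracket_smul_right hf ((F.contMDiff 0 x).mdifferentiableAt (by simp))]
  simp [F.orthonormal, eta]

lemma _root_.VectorField.contMDiff_mlieBracket {V W : ∀ x : M, TangentSpace (𝓡 4) x}
    (hV : ContMDiff (𝓡 4) ((𝓡 4).prod 𝓘(ℝ, E4)) ∞ (fun x ↦ (⟨x, V x⟩ : TangentBundle (𝓡 4) M)))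
    (hW : ContMDiff (𝓡 4) ((𝓡 4).prod 𝓘(ℝ, E4)) ∞ (fun x ↦ (⟨x, W x⟩ : TangentBundle (𝓡 4) M))) :
    ContMDiff (𝓡 4) ((𝓡 4).prod 𝓘(ℝ, E4)) ∞
      (fun x ↦ (⟨x, mlieBracket (𝓡 4) V W x⟩ : TangentBundle (𝓡 4) M)) := by
  have : IsManifold (𝓡 4) (((⊤ : ℕ∞) : WithTop ℕ∞) + 1) M := by
    simpa using (inferInstance : IsManifold (𝓡 4) ∞ M)
  have : IsManifold (𝓡 4) (minSmoothness ℝ 2) M :=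
    IsManifold.of_le (n := ∞) (by simpa using two_le_infty)
  exact ContDiff.mlieBracket_vectorField (n := ⊤) (m := ⊤) hV hW (by simp)

lemma _root_.SpinGeometry.LorentzMetric.contMDiff_apply (g : LorentzMetric M)
    {V W : ∀ x : M, TangentSpace (𝓡 4) x}
    (hV : ContMDiff (𝓡 4) ((𝓡 4).prod 𝓘(ℝ, E4)) ∞ (fun x ↦ (⟨x, V x⟩ : TangentBundle (𝓡 4) M)))
    (hW : ContMDiff (𝓡 4) ((𝓡 4).prod 𝓘(ℝ, E4)) ∞ (fun x ↦ (⟨x, W x⟩ : TangentBundle (𝓡 4) M))) :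
    ContMDiff (𝓡 4) 𝓘(ℝ, ℝ) ∞ (fun x ↦ g.val x (V x) (W x)) := by
  have h : ContMDiff (𝓡 4) ((𝓡 4).prod 𝓘(ℝ, ℝ)) ∞
      (fun x ↦ Bundle.TotalSpace.mk' ℝ (E := Bundle.Trivial M ℝ) x (g.val x (V x) (W x))) :=
    ContMDiff.clm_bundle_apply₂ (F₁ := E4) (F₂ := E4) (F₃ := ℝ) g.contMDiff hV hW
  intro x
  have h' := h x
  simp only [Bundle.contMDiffAt_totalSpace] at h'
  exact h'.2

lemma contMDiff_smul_vec (a : Fin 4) {f : M → ℝ} (hf : ContMDiff (𝓡 4) 𝓘(ℝ, ℝ) ∞ f) :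
    ContMDiff (𝓡 4) ((𝓡 4).prod 𝓘(ℝ, E4)) ∞
      (fun x ↦ (⟨x, (f • F.vec a) x⟩ : TangentBundle (𝓡 4) M)) :=
  hf.smul_section (F.contMDiff a)

lemma contMDiff_dR (a : Fin 4) {f : M → ℝ} (hf : ContMDiff (𝓡 4) 𝓘(ℝ, ℝ) ∞ f) :
    ContMDiff (𝓡 4) 𝓘(ℝ, ℝ) ∞ (F.dR a f) := by
  have h : F.dR a f = fun x ↦ g.val x (mlieBracket (𝓡 4) (F.vec a) (f • F.vec 0) x) (F.vec 0 x)
      - f x * g.val x (mlieBracket (𝓡 4) (F.vec a) (F.vec 0) x) (F.vec 0 x) :=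
    funext fun x ↦ F.dR_eq_bracket (F.vec a) ((hf x).mdifferentiableAt (by simp))
  rw [h]
  exact (g.contMDiff_apply (contMDiff_mlieBracket (F.contMDiff a) (F.contMDiff_smul_vec 0 hf))
    (F.contMDiff 0)).sub (hf.mul (g.contMDiff_apply
      (contMDiff_mlieBracket (F.contMDiff a) (F.contMDiff 0)) (F.contMDiff 0)))

lemma contMDiff_bracket (a b c : Fin 4) : ContMDiff (𝓡 4) 𝓘(ℝ, ℝ) ∞ (F.bracket a b c) :=
  g.contMDiff_apply (contMDiff_mlieBracket (F.contMDiff a) (F.contMDiff b)) (F.contMDiff c)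

lemma bracketUp_eq (a b c : Fin 4) (x : M) :
    F.bracketUp a b c x = F.bracket a b c x * eta c c := by
  rw [bracketUp, Finset.sum_eq_single c] <;> simp +contextual [eta_of_ne]

lemma connUp_eq (a b c : Fin 4) (x : M) : F.connUp a b c x = F.conn a b c x * eta c c := by
  rw [connUp, Finset.sum_eq_single c] <;> simp +contextual [eta_of_ne]

lemma contMDiff_bracketUp (a b c : Fin 4) : ContMDiff (𝓡 4) 𝓘(ℝ, ℝ) ∞ (F.bracketUp a b c) := by
  rw [show F.bracketUp a b c = fun x ↦ F.bracket a b c x * eta c c from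
    funext (F.bracketUp_eq a b c)]
  exact (F.contMDiff_bracket a b c).mul contMDiff_const

lemma mlieBracket_vec (a b : Fin 4) :
    mlieBracket (𝓡 4) (F.vec a) (F.vec b) = fun x ↦ ∑ c, F.bracketUp a b c x • F.vec c x := by
  funext x
  simp_rw [bracketUp_eq]
  exact F.expand x _

/-- The commutator of two tetrad derivatives of a real function. -/
lemma dR_comm (a b : Fin 4) {f : M → ℝ} (hf : ContMDiff (𝓡 4) 𝓘(ℝ, ℝ) ∞ f) (x : M) :
    F.dR a (F.dR b f) x - F.dR b (F.dR a f) x = ∑ c, F.bracketUp a b c x * F.dR c f x := by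
  have hm : ∀ {h : M → ℝ}, ContMDiff (𝓡 4) 𝓘(ℝ, ℝ) ∞ h → ∀ x,
    MDifferentiableAt (𝓡 4) 𝓘(ℝ, ℝ) h x := fun hh x ↦ (hh x).mdifferentiableAt (by simp)
  have h2 : ∀ {V : ∀ x : M, TangentSpace (𝓡 4) x}, ContMDiff (𝓡 4) ((𝓡 4).prod 𝓘(ℝ, E4)) ∞
      (fun x ↦ (⟨x, V x⟩ : TangentBundle (𝓡 4) M)) → ContMDiff (𝓡 4) ((𝓡 4).prod 𝓘(ℝ, E4))
      (minSmoothness ℝ 2) (fun x ↦ (⟨x, V x⟩ : TangentBundle (𝓡 4) M)) :=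
    fun h ↦ h.of_le (by simpa using two_le_infty)
  have hd : ∀ {V : ∀ x : M, TangentSpace (𝓡 4) x}, ContMDiff (𝓡 4) ((𝓡 4).prod 𝓘(ℝ, E4)) ∞
      (fun x ↦ (⟨x, V x⟩ : TangentBundle (𝓡 4) M)) → ∀ x, MDifferentiableAt (𝓡 4)
      ((𝓡 4).prod 𝓘(ℝ, E4)) (fun x ↦ (⟨x, V x⟩ : TangentBundle (𝓡 4) M)) x :=
    fun h x ↦ (h x).mdifferentiableAt (by simp)
  have : IsManifold (𝓡 4) (minSmoothness ℝ 3) M :=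
    IsManifold.of_le (n := ∞) (by simpa using three_le_infty)
  have sm : ∀ (V : ∀ x : M, TangentSpace (𝓡 4) x) {h : M → ℝ} {W : ∀ x : M, TangentSpace (𝓡 4) x},
      ContMDiff (𝓡 4) 𝓘(ℝ, ℝ) ∞ h → ContMDiff (𝓡 4) ((𝓡 4).prod 𝓘(ℝ, E4)) ∞
      (fun x ↦ (⟨x, W x⟩ : TangentBundle (𝓡 4) M)) →
      mlieBracket (𝓡 4) V (h • W) =
        (fun x ↦ mvfderiv (𝓡 4) h x (V x)) • W + h • mlieBracket (𝓡 4) V W :=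
    fun V h W hh hW ↦ funext fun x ↦ mlieBracket_smul_right (hm hh x) (hd hW x)
  have br : ∀ a, ContMDiff (𝓡 4) ((𝓡 4).prod 𝓘(ℝ, E4)) ∞ (fun x ↦
      (⟨x, mlieBracket (𝓡 4) (F.vec a) (F.vec 0) x⟩ : TangentBundle (𝓡 4) M)) :=
    fun a ↦ contMDiff_mlieBracket (F.contMDiff a) (F.contMDiff 0)
  have nest : ∀ a b, mlieBracket (𝓡 4) (F.vec a) (mlieBracket (𝓡 4) (F.vec b) (f • F.vec 0)) x =
      F.dR a (F.dR b f) x • F.vec 0 x + F.dR b f x • mlieBracket (𝓡 4) (F.vec a) (F.vec 0) x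
      + (F.dR a f x • mlieBracket (𝓡 4) (F.vec b) (F.vec 0) x
      + f x • mlieBracket (𝓡 4) (F.vec a) (mlieBracket (𝓡 4) (F.vec b) (F.vec 0)) x) := by
    intro a b
    rw [sm (F.vec b) hf (F.contMDiff 0), mlieBracket_add_right]
    · rw [sm (F.vec a) hf (br b)]
      have := sm (F.vec a) (F.contMDiff_dR b hf) (F.contMDiff 0)
      erw [this]
      rfl
    · exact hd ((F.contMDiff_dR b hf).smul_section (F.contMDiff 0)) x
    · exact hd (hf.smul_section (br b)) x
  have J1 := leibniz_identity_mlieBracket_apply (h2 (F.contMDiff a) x) (h2 (F.contMDiff b) x)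
    (h2 (F.contMDiff_smul_vec 0 hf) x)
  have J0 := leibniz_identity_mlieBracket_apply (h2 (F.contMDiff a) x) (h2 (F.contMDiff b) x)
    (h2 (F.contMDiff 0) x)
  rw [nest a b, nest b a, J0, sm _ hf (F.contMDiff 0)] at J1
  have key : (F.dR a (F.dR b f) x - F.dR b (F.dR a f) x) • F.vec 0 x
      = mvfderiv (𝓡 4) f x (mlieBracket (𝓡 4) (F.vec a) (F.vec b) x) • F.vec 0 x := by
    simp only [Pi.add_apply, Pi.smul_apply', smul_add] at J1
    rw [sub_smul]
    rw [← sub_eq_zero] at J1 ⊢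
    rw [← J1]
    module
  have k2 := congrArg (fun v ↦ g.val x v (F.vec 0 x)) key
  simp only [map_smul, smul_apply, F.orthonormal, eta, smul_eq_mul] at k2
  rw [mlieBracket_vec] at k2
  simpa [dR_eq] using k2

end SpinFrame

/-- Smoothness of a complex function on the manifold. -/
abbrev IsSmooth {M : Type*} [TopologicalSpace M] [ChartedSpace E4 M] (f : M → ℂ) : Prop :=
  ContMDiff (𝓡 4) 𝓘(ℝ, ℂ) ∞ f

section Smooth

variable {M : Type*} [TopologicalSpace M] [ChartedSpace E4 M] {f h : M → ℂ}

lemma IsSmooth.mdiff (hf : IsSmooth f) (x : M) : MDifferentiableAt (𝓡 4) 𝓘(ℝ, ℂ) f x :=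
  (hf x).mdifferentiableAt (by simp)

lemma isSmooth_ofReal {f : M → ℝ} (hf : ContMDiff (𝓡 4) 𝓘(ℝ, ℝ) ∞ f) :
    IsSmooth (fun x ↦ (f x : ℂ)) :=
  Complex.ofRealCLM.contDiff.contMDiff.comp hf

lemma IsSmooth.re (hf : IsSmooth f) : ContMDiff (𝓡 4) 𝓘(ℝ, ℝ) ∞ (fun x ↦ (f x).re) :=
  Complex.reCLM.contDiff.contMDiff.comp hf

lemma IsSmooth.im (hf : IsSmooth f) : ContMDiff (𝓡 4) 𝓘(ℝ, ℝ) ∞ (fun x ↦ (f x).im) :=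
  Complex.imCLM.contDiff.contMDiff.comp hf

lemma IsSmooth.fadd (hf : IsSmooth f) (hh : IsSmooth h) : IsSmooth (fun x ↦ f x + h x) :=
  ContMDiff.add hf hh

lemma IsSmooth.fsub (hf : IsSmooth f) (hh : IsSmooth h) : IsSmooth (fun x ↦ f x - h x) :=
  ContMDiff.sub hf hh

lemma IsSmooth.fmul (hf : IsSmooth f) (hh : IsSmooth h) : IsSmooth (fun x ↦ f x * h x) :=
  (contDiff_mul (𝕜 := ℝ) (𝔸 := ℂ)).contMDiff.comp (hf.prodMk_space hh)

lemma isSmooth_const (c : ℂ) : IsSmooth (fun _ : M ↦ c) := contMDiff_const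

lemma isSmooth_sum {ι : Type*} {s : Finset ι} {f : ι → M → ℂ} (hf : ∀ i, IsSmooth (f i)) :
    IsSmooth (fun x ↦ ∑ i ∈ s, f i x) :=
  contMDiff_finsetSum fun i _ ↦ hf i

end Smooth

namespace SpinFrame

variable {M : Type*} [TopologicalSpace M] [ChartedSpace E4 M] [IsManifold (𝓡 4) ∞ M]
  {g : LorentzMetric M} (F : SpinFrame g)

lemma dC_eq_re_im (a : Fin 4) {f : M → ℂ} (hf : IsSmooth f) :
    F.dC a f = fun x ↦ (F.dR a (fun y ↦ (f y).re) x : ℂ)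
      + Complex.I * (F.dR a (fun y ↦ (f y).im) x : ℂ) := by
  funext x
  have h : f = fun y ↦ ((f y).re : ℂ) + Complex.I * ((f y).im : ℂ) := by
    funext y; rw [mul_comm]; exact (Complex.re_add_im _).symm
  conv_lhs => rw [h]
  rw [F.dC_add a ((isSmooth_ofReal hf.re).mdiff x)
      (((isSmooth_const _).fmul (isSmooth_ofReal hf.im)).mdiff x),
    F.dC_const_mul a _ ((isSmooth_ofReal hf.im).mdiff x),
    F.dC_ofReal a ((hf.re x).mdifferentiableAt (by simp)),
    F.dC_ofReal a ((hf.im x).mdifferentiableAt (by simp))]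

lemma isSmooth_dC (a : Fin 4) {f : M → ℂ} (hf : IsSmooth f) : IsSmooth (F.dC a f) := by
  rw [F.dC_eq_re_im a hf]
  exact (isSmooth_ofReal (F.contMDiff_dR a hf.re)).fadd
    ((isSmooth_const _).fmul (isSmooth_ofReal (F.contMDiff_dR a hf.im)))

/-- The commutator of two tetrad derivatives of a complex function. -/
lemma dC_comm (a b : Fin 4) {f : M → ℂ} (hf : IsSmooth f) (x : M) :
    F.dC a (F.dC b f) x - F.dC b (F.dC a f) x = ∑ c, (F.bracketUp a b c x : ℂ) * F.dC c f x := by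
  have h : ∀ a b, F.dC a (F.dC b f) x = (F.dR a (F.dR b fun y ↦ (f y).re) x : ℂ)
      + Complex.I * (F.dR a (F.dR b fun y ↦ (f y).im) x : ℂ) := by
    intro a b
    have hr := F.contMDiff_dR b hf.re
    have hi := F.contMDiff_dR b hf.im
    rw [F.dC_eq_re_im b hf, F.dC_add a ((isSmooth_ofReal hr).mdiff x)
      (((isSmooth_const _).fmul (isSmooth_ofReal hi)).mdiff x),
      F.dC_const_mul a _ ((isSmooth_ofReal hi).mdiff x),
      F.dC_ofReal a ((hr x).mdifferentiableAt (by simp)),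
      F.dC_ofReal a ((hi x).mdifferentiableAt (by simp))]
  have hr := congrArg (fun r : ℝ ↦ (r : ℂ)) (F.dR_comm a b hf.re x)
  have hi := congrArg (fun r : ℝ ↦ (r : ℂ)) (F.dR_comm a b hf.im x)
  push_cast at hr hi
  simp_rw [h, F.dC_eq_re_im _ hf, mul_add, Finset.sum_add_distrib, mul_left_comm _ Complex.I,
    ← Finset.mul_sum]
  linear_combination hr + Complex.I * hi

lemma bracket_swap (a b c : Fin 4) (x : M) : F.bracket a b c x = - F.bracket b a c x := by
  rw [bracket, mlieBracket_swap_apply, map_neg, neg_apply]; rfl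

lemma metric_mlieBracket_mlieBracket (a b c d : Fin 4) (x : M) :
    g.val x (mlieBracket (𝓡 4) (F.vec a) (mlieBracket (𝓡 4) (F.vec b) (F.vec c)) x) (F.vec d x)
      = F.dR a (F.bracketUp b c d) x * eta d d
        + ∑ e, F.bracketUp b c e x * F.bracket a e d x := by
  have h1 : ∀ e, MDifferentiableAt (𝓡 4) 𝓘(ℝ, ℝ) (F.bracketUp b c e) x := fun e ↦
    (F.contMDiff_bracketUp b c e x).mdifferentiableAt (by simp)
  have h2 : ∀ e, MDifferentiableAt (𝓡 4) ((𝓡 4).prod 𝓘(ℝ, E4))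
      (fun x ↦ (⟨x, F.vec e x⟩ : TangentBundle (𝓡 4) M)) x := fun e ↦
    (F.contMDiff e x).mdifferentiableAt (by simp)
  have h3 : ∀ e, ContMDiff (𝓡 4) ((𝓡 4).prod 𝓘(ℝ, E4)) ∞
      (fun x ↦ (⟨x, (F.bracketUp b c e • F.vec e) x⟩ : TangentBundle (𝓡 4) M)) := fun e ↦
    F.contMDiff_smul_vec e (F.contMDiff_bracketUp b c e)
  have hd : ∀ {V : ∀ x : M, TangentSpace (𝓡 4) x}, ContMDiff (𝓡 4) ((𝓡 4).prod 𝓘(ℝ, E4)) ∞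
      (fun x ↦ (⟨x, V x⟩ : TangentBundle (𝓡 4) M)) → MDifferentiableAt (𝓡 4)
      ((𝓡 4).prod 𝓘(ℝ, E4)) (fun x ↦ (⟨x, V x⟩ : TangentBundle (𝓡 4) M)) x :=
    fun h ↦ (h x).mdifferentiableAt (by simp)
  have hs : mlieBracket (𝓡 4) (F.vec b) (F.vec c) = F.bracketUp b c 0 • F.vec 0
      + F.bracketUp b c 1 • F.vec 1 + F.bracketUp b c 2 • F.vec 2 + F.bracketUp b c 3 • F.vec 3 := by
    rw [mlieBracket_vec]
    funext y
    simp [Fin.sum_univ_four]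
  rw [hs, mlieBracket_add_right
      (hd (((h3 0).add_section (h3 1)).add_section (h3 2))) (hd (h3 3)),
    mlieBracket_add_right (hd ((h3 0).add_section (h3 1))) (hd (h3 2)),
    mlieBracket_add_right (hd (h3 0)) (hd (h3 1))]
  simp_rw [fun e ↦ mlieBracket_smul_right (V := F.vec a) (h1 e) (h2 e)]
  have hd : F.dR a (F.bracketUp b c d) x * eta d d
      = ∑ e, F.dR a (F.bracketUp b c e) x * eta e d := by
    rw [Finset.sum_eq_single d] <;> simp +contextual [eta_of_ne]
  rw [hd, Fin.sum_univ_four, Fin.sum_univ_four]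
  simp only [map_add, map_smul, add_apply, smul_apply, F.orthonormal, smul_eq_mul, dR_eq, bracket]
  ring

/-- The Jacobi identity in terms of the structure functions of the tetrad. -/
lemma jacobi (a b c d : Fin 4) (x : M) :
    F.dR a (F.bracketUp b c d) x + F.dR b (F.bracketUp c a d) x + F.dR c (F.bracketUp a b d) x
      + ∑ e, (F.bracketUp b c e x * F.bracketUp a e d x + F.bracketUp c a e x * F.bracketUp b e d x
        + F.bracketUp a b e x * F.bracketUp c e d x) = 0 := by
  have h2 : ∀ a, ContMDiffAt (𝓡 4) ((𝓡 4).prod 𝓘(ℝ, E4))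
      (minSmoothness ℝ 2) (fun x ↦ (⟨x, F.vec a x⟩ : TangentBundle (𝓡 4) M)) x :=
    fun a ↦ ((F.contMDiff a).of_le (by simpa using two_le_infty)) x
  have : IsManifold (𝓡 4) (minSmoothness ℝ 3) M :=
    IsManifold.of_le (n := ∞) (by simpa using three_le_infty)
  have hJ := leibniz_identity_mlieBracket_apply (h2 a) (h2 b) (h2 c)
  have hca : mlieBracket (𝓡 4) (F.vec b) (mlieBracket (𝓡 4) (F.vec a) (F.vec c)) x
      = - mlieBracket (𝓡 4) (F.vec b) (mlieBracket (𝓡 4) (F.vec c) (F.vec a)) x := by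
    have h := mlieBracket_const_smul_right (c := (-1 : ℝ)) (V := F.vec b) (x := x)
      (W := mlieBracket (𝓡 4) (F.vec c) (F.vec a))
      ((contMDiff_mlieBracket (F.contMDiff c) (F.contMDiff a) x).mdifferentiableAt (by simp))
    rw [mlieBracket_swap (V := F.vec a)]
    simpa using h
  rw [mlieBracket_swap_apply (V := mlieBracket (𝓡 4) (F.vec a) (F.vec b)), hca] at hJ
  have h := congrArg (fun v ↦ g.val x v (F.vec d x) * eta d d) hJ
  simp only [map_add, map_neg, add_apply, neg_apply, metric_mlieBracket_mlieBracket] at h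
  simp only [bracketUp_eq _ _ _ d x, Finset.sum_add_distrib, ← mul_assoc, ← Finset.sum_mul]
  linear_combination h + (-(F.dR a (F.bracketUp b c d) x + F.dR b (F.bracketUp c a d) x
    + F.dR c (F.bracketUp a b d) x)) * eta_self_mul_self d

end SpinFrame

namespace SpinFrame

variable {M : Type*} [TopologicalSpace M] [ChartedSpace E4 M] [IsManifold (𝓡 4) ∞ M]
  {g : LorentzMetric M} (F : SpinFrame g)

lemma dR_mul_const (a : Fin 4) (c : ℝ) {f : M → ℝ} {x : M}
    (hf : MDifferentiableAt (𝓡 4) 𝓘(ℝ, ℝ) f x) :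
    F.dR a (fun y ↦ f y * c) x = F.dR a f x * c := by
  have := congrArg (fun T ↦ T (F.vec a x))
    (hf.hasMFDerivAt.mul (mdifferentiableAt_const (c := c)).hasMFDerivAt).mfderiv
  refine this.trans ?_
  rw [mfderiv_const]
  change f x * 0 + c * _ = _
  rw [mul_zero, zero_add, mul_comm]
  rfl

lemma dR_sub (a : Fin 4) {f h : M → ℝ} {x : M} (hf : MDifferentiableAt (𝓡 4) 𝓘(ℝ, ℝ) f x)
    (hh : MDifferentiableAt (𝓡 4) 𝓘(ℝ, ℝ) h x) :
    F.dR a (fun y ↦ f y - h y) x = F.dR a f x - F.dR a h x := by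
  have := congrArg (fun T ↦ T (F.vec a x)) (hf.hasMFDerivAt.sub hh.hasMFDerivAt).mfderiv
  exact this

lemma dR_neg (a : Fin 4) {f : M → ℝ} {x : M} :
    F.dR a (fun y ↦ - f y) x = - F.dR a f x := by
  have := congrArg (fun T ↦ T (F.vec a x)) (mfderiv_neg (I := 𝓡 4) (f := f) (x := x))
  exact this

/-! ### The Levi-Civita connection -/

lemma conn_swap (a b c : Fin 4) (x : M) : F.conn a b c x = - F.conn a c b x := by
  simp only [conn]
  rw [F.bracket_swap a c b, F.bracket_swap c b a, F.bracket_swap b a c]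
  ring

lemma bracket_eq_conn (a b c : Fin 4) (x : M) :
    F.bracket a b c x = F.conn a b c x - F.conn b a c x := by
  simp only [conn]
  rw [F.bracket_swap b a c, F.bracket_swap a c b, F.bracket_swap c b a]
  ring

lemma contMDiff_conn (a b c : Fin 4) : ContMDiff (𝓡 4) 𝓘(ℝ, ℝ) ∞ (F.conn a b c) := by
  rw [show F.conn a b c = fun x ↦
      (F.bracket a b c x - F.bracket b c a x + F.bracket c a b x) * 2⁻¹ from
    funext fun x ↦ div_eq_mul_inv _ _]
  exact (((F.contMDiff_bracket a b c).sub (F.contMDiff_bracket b c a)).add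
    (F.contMDiff_bracket c a b)).mul contMDiff_const

lemma mdiff_conn (a b c : Fin 4) (x : M) : MDifferentiableAt (𝓡 4) 𝓘(ℝ, ℝ) (F.conn a b c) x :=
  (F.contMDiff_conn a b c x).mdifferentiableAt (by simp)

lemma contMDiff_connUp (a b c : Fin 4) : ContMDiff (𝓡 4) 𝓘(ℝ, ℝ) ∞ (F.connUp a b c) := by
  rw [show F.connUp a b c = fun x ↦ F.conn a b c x * eta c c from funext (F.connUp_eq a b c)]
  exact (F.contMDiff_conn a b c).mul contMDiff_const

/-! ### The Riemann tensor -/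

lemma contMDiff_riemannUp (a b c d : Fin 4) :
    ContMDiff (𝓡 4) 𝓘(ℝ, ℝ) ∞ (F.riemannUp a b c d) := by
  refine ((F.contMDiff_dR a (F.contMDiff_connUp b c d)).sub
    (F.contMDiff_dR b (F.contMDiff_connUp a c d))).add (contMDiff_finsetSum fun e _ ↦ ?_)
  exact (((F.contMDiff_connUp b c e).mul (F.contMDiff_connUp a e d)).sub
    ((F.contMDiff_connUp a c e).mul (F.contMDiff_connUp b e d))).sub
    ((F.contMDiff_bracketUp a b e).mul (F.contMDiff_connUp e c d))

lemma contMDiff_riemann (a b c d : Fin 4) : ContMDiff (𝓡 4) 𝓘(ℝ, ℝ) ∞ (F.riemann a b c d) :=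
  contMDiff_finsetSum fun e _ ↦ (F.contMDiff_riemannUp a b c e).mul contMDiff_const

lemma riemann_eq_riemannUp (a b c d : Fin 4) (x : M) :
    F.riemann a b c d x = F.riemannUp a b c d x * eta d d := by
  rw [riemann, Finset.sum_eq_single d] <;> simp +contextual [eta_of_ne]

lemma riemannUp_eq_riemann (a b c d : Fin 4) (x : M) :
    F.riemannUp a b c d x = F.riemann a b c d x * eta d d := by
  rw [riemann_eq_riemannUp, mul_assoc, eta_self_mul_self, mul_one]

lemma ricci_eq (a b : Fin 4) (x : M) :
    F.ricci a b x = ∑ c, F.riemann a c b c x * eta c c := by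
  simp_rw [ricci, riemannUp_eq_riemann]

lemma riemann_eq (a b c d : Fin 4) (x : M) :
    F.riemann a b c d x = F.dR a (F.conn b c d) x - F.dR b (F.conn a c d) x
      + ∑ e, eta e e * (F.conn b c e x * F.conn a e d x - F.conn a c e x * F.conn b e d x
        - F.bracket a b e x * F.conn e c d x) := by
  have h : ∀ a b c, F.connUp a b c = fun x ↦ F.conn a b c x * eta c c :=
    fun a b c ↦ funext (F.connUp_eq a b c)
  rw [riemann_eq_riemannUp, riemannUp, h b c d, h a c d, F.dR_mul_const _ _ (F.mdiff_conn _ _ _ _),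
    F.dR_mul_const _ _ (F.mdiff_conn _ _ _ _), add_mul, Finset.sum_mul]
  congr 1
  · linear_combination (F.dR a (F.conn b c d) x - F.dR b (F.conn a c d) x) * eta_self_mul_self d
  · refine Finset.sum_congr rfl fun e _ ↦ ?_
    simp only [connUp_eq, bracketUp_eq]
    linear_combination eta e e * (F.conn b c e x * F.conn a e d x - F.conn a c e x * F.conn b e d x
        - F.bracket a b e x * F.conn e c d x) * eta_self_mul_self d

lemma riemann_swap_left (a b c d : Fin 4) (x : M) :
    F.riemann a b c d x = - F.riemann b a c d x := by
  simp only [riemann_eq, Fin.sum_univ_four, F.bracket_swap a b]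
  ring

lemma riemann_swap_right (a b c d : Fin 4) (x : M) :
    F.riemann a b c d x = - F.riemann a b d c x := by
  have h : ∀ a, F.conn a c d = fun x ↦ - F.conn a d c x := fun a ↦ funext (F.conn_swap a c d)
  simp only [riemann_eq, Fin.sum_univ_four, h, dR_neg]
  simp only [fun a e ↦ F.conn_swap a c e x, fun a e ↦ F.conn_swap a e d x]
  ring

/-- The first Bianchi identity. -/
lemma riemann_cyclic (a b c d : Fin 4) (x : M) :
    F.riemann a b c d x + F.riemann b c a d x + F.riemann c a b d x = 0 := by
  have hJ := F.jacobi a b c d x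
  have h : ∀ a b, F.bracketUp a b d = fun x ↦ F.bracket a b d x * eta d d :=
    fun a b ↦ funext (F.bracketUp_eq a b d)
  have hb : ∀ a b, F.bracket a b d = fun x ↦ F.conn a b d x - F.conn b a d x :=
    fun a b ↦ funext (F.bracket_eq_conn a b d)
  have hm : ∀ a b, MDifferentiableAt (𝓡 4) 𝓘(ℝ, ℝ) (F.bracket a b d) x :=
    fun a b ↦ (F.contMDiff_bracket a b d x).mdifferentiableAt (by simp)
  have hd : ∀ e a b, F.dR e (F.bracketUp a b d) x
      = (F.dR e (F.conn a b d) x - F.dR e (F.conn b a d) x) * eta d d := fun e a b ↦ by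
    rw [h, F.dR_mul_const _ _ (hm a b), hb, F.dR_sub _ (F.mdiff_conn _ _ _ _) (F.mdiff_conn _ _ _ _)]
  simp only [hd, bracketUp_eq, Fin.sum_univ_four, bracket_eq_conn] at hJ
  simp only [riemann_eq, Fin.sum_univ_four, bracket_eq_conn]
  have e := eta_self_mul_self d
  have hne : eta d d ≠ 0 := fun h0 ↦ by simp [h0] at e
  refine mul_right_cancel₀ hne ?_
  linear_combination hJ

end SpinFrame

namespace SpinFrame

variable {M : Type*} [TopologicalSpace M] [ChartedSpace E4 M] [IsManifold (𝓡 4) ∞ M]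
  {g : LorentzMetric M} (F : SpinFrame g)

lemma dC_sum (a : Fin 4) {ι : Type*} (s : Finset ι) {f : ι → M → ℂ} (hf : ∀ i, IsSmooth (f i))
    (x : M) : F.dC a (fun y ↦ ∑ i ∈ s, f i y) x = ∑ i ∈ s, F.dC a (f i) x := by
  classical
  induction s using Finset.induction_on with
  | empty => simpa using F.dC_const a 0 x
  | insert i s hi ih =>
    simp_rw [Finset.sum_insert hi]
    rw [F.dC_add a ((hf i).mdiff x) ((isSmooth_sum hf).mdiff x), ih]

/-! ### Exterior derivatives in the tetrad -/

/-- The structure functions of the tetrad as complex functions. -/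
def struct (a b c : Fin 4) (x : M) : ℂ := (F.bracketUp a b c x : ℂ)

lemma isSmooth_struct (a b c : Fin 4) : IsSmooth (F.struct a b c) :=
  isSmooth_ofReal (F.contMDiff_bracketUp a b c)

lemma struct_jacobi (a b c d : Fin 4) (x : M) :
    F.dC a (F.struct b c d) x + F.dC b (F.struct c a d) x + F.dC c (F.struct a b d) x
      + ∑ e, (F.struct b c e x * F.struct a e d x + F.struct c a e x * F.struct b e d x
        + F.struct a b e x * F.struct c e d x) = 0 := by
  have hm : ∀ a b c, MDifferentiableAt (𝓡 4) 𝓘(ℝ, ℝ) (F.bracketUp a b c) x := fun a b c ↦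
    (F.contMDiff_bracketUp a b c x).mdifferentiableAt (by simp)
  have h : ∀ e a b c, F.dC e (F.struct a b c) x = (F.dR e (F.bracketUp a b c) x : ℂ) :=
    fun e a b c ↦ F.dC_ofReal e (hm a b c)
  simp_rw [h, struct]
  exact_mod_cast F.jacobi a b c d x

/-- The components `(du)(Eₐ, E_b)` of the exterior derivative of the one-form with components
`u_a = u(Eₐ)`. -/
def extD (u : Fin 4 → M → ℂ) (a b : Fin 4) (x : M) : ℂ :=
  F.dC a (u b) x - F.dC b (u a) x - ∑ e, F.struct a b e x * u e x

lemma isSmooth_extD {u : Fin 4 → M → ℂ} (hu : ∀ a, IsSmooth (u a)) (a b : Fin 4) :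
    IsSmooth (F.extD u a b) :=
  ((F.isSmooth_dC a (hu b)).fsub (F.isSmooth_dC b (hu a))).fsub
    (isSmooth_sum fun e ↦ (F.isSmooth_struct a b e).fmul (hu e))

lemma dC_extD {u : Fin 4 → M → ℂ} (hu : ∀ a, IsSmooth (u a)) (a b c : Fin 4) (x : M) :
    F.dC a (F.extD u b c) x = F.dC a (F.dC b (u c)) x - F.dC a (F.dC c (u b)) x
      - ∑ e, (F.struct b c e x * F.dC a (u e) x + u e x * F.dC a (F.struct b c e) x) := by
  have h1 := F.isSmooth_dC b (hu c)
  have h2 := F.isSmooth_dC c (hu b)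
  have h3 := fun e ↦ (F.isSmooth_struct b c e).fmul (hu e)
  have h : F.extD u b c = fun x ↦ F.dC b (u c) x - F.dC c (u b) x
      - ∑ e, F.struct b c e x * u e x := rfl
  rw [h, F.dC_sub a ((h1.fsub h2).mdiff x) ((isSmooth_sum h3).mdiff x),
    F.dC_sub a (h1.mdiff x) (h2.mdiff x), F.dC_sum a _ h3]
  simp_rw [fun e ↦ F.dC_mul a ((F.isSmooth_struct b c e).mdiff x) ((hu e).mdiff x)]

/-- `d² = 0` on one-forms. -/
lemma extD_extD {u : Fin 4 → M → ℂ} (hu : ∀ a, IsSmooth (u a)) (a b c : Fin 4) (x : M) :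
    F.dC a (F.extD u b c) x + F.dC b (F.extD u c a) x + F.dC c (F.extD u a b) x
      + ∑ e, (F.struct b c e x * F.extD u a e x + F.struct c a e x * F.extD u b e x
        + F.struct a b e x * F.extD u c e x) = 0 := by
  have J := fun d ↦ F.struct_jacobi a b c d x
  have h1 := F.dC_comm a b (hu c) x
  have h2 := F.dC_comm b c (hu a) x
  have h3 := F.dC_comm c a (hu b) x
  have J0 := J 0
  have J1 := J 1
  have J2 := J 2
  have J3 := J 3
  have hs : ∀ a b c, (F.bracketUp a b c x : ℂ) = F.struct a b c x := fun _ _ _ ↦ rfl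
  simp only [dC_extD F hu, extD, Fin.sum_univ_four, hs] at *
  linear_combination h1 + h2 + h3 - u 0 x * J0 - u 1 x * J1 - u 2 x * J2 - u 3 x * J3

/-- The second Bianchi identity for a connection with values in the complex Lie algebra
`(ℂ³, i ×)`, in components. -/
lemma bianchi_component {u v w : Fin 4 → M → ℂ} (hu : ∀ a, IsSmooth (u a))
    (hv : ∀ a, IsSmooth (v a)) (hw : ∀ a, IsSmooth (w a)) {f₁ f₂ f₃ : Fin 4 → Fin 4 → M → ℂ}
    (h₁ : ∀ a b x, f₁ a b x = F.extD u a b x + Complex.I * (v a x * w b x - w a x * v b x))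
    (h₂ : ∀ a b x, f₂ a b x = F.extD v a b x + Complex.I * (w a x * u b x - u a x * w b x))
    (h₃ : ∀ a b x, f₃ a b x = F.extD w a b x + Complex.I * (u a x * v b x - v a x * u b x))
    (a b c : Fin 4) (x : M) :
    F.dC a (f₁ b c) x + F.dC b (f₁ c a) x + F.dC c (f₁ a b) x
      + Complex.I * (v a x * f₃ b c x - w a x * f₂ b c x + (v b x * f₃ c a x - w b x * f₂ c a x)
        + (v c x * f₃ a b x - w c x * f₂ a b x))
      + ∑ e, (F.struct b c e x * f₁ a e x + F.struct c a e x * f₁ b e x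
        + F.struct a b e x * f₁ c e x) = 0 := by
  have hd : ∀ a b c, F.dC a (f₁ b c) x = F.dC a (F.extD u b c) x + Complex.I *
      (v b x * F.dC a (w c) x + w c x * F.dC a (v b) x
        - (w b x * F.dC a (v c) x + v c x * F.dC a (w b) x)) := by
    intro a b c
    rw [show f₁ b c = fun x ↦ F.extD u b c x + Complex.I * (v b x * w c x - w b x * v c x) from
        funext (h₁ b c),
      F.dC_add a ((F.isSmooth_extD hu b c).mdiff x) (((isSmooth_const _).fmul
        (((hv b).fmul (hw c)).fsub ((hw b).fmul (hv c)))).mdiff x),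
      F.dC_const_mul a _ ((((hv b).fmul (hw c)).fsub ((hw b).fmul (hv c))).mdiff x),
      F.dC_sub a (((hv b).fmul (hw c)).mdiff x) (((hw b).fmul (hv c)).mdiff x),
      F.dC_mul a ((hv b).mdiff x) ((hw c).mdiff x), F.dC_mul a ((hw b).mdiff x) ((hv c).mdiff x)]
  have E := F.extD_extD hu a b c x
  simp only [hd, h₁, h₂, h₃]
  have e2 : ∀ a b, F.extD v a b x = F.dC a (v b) x - F.dC b (v a) x
    - ∑ e, F.struct a b e x * v e x := fun _ _ ↦ rfl
  have e3 : ∀ a b, F.extD w a b x = F.dC a (w b) x - F.dC b (w a) x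
    - ∑ e, F.struct a b e x * w e x := fun _ _ ↦ rfl
  simp only [e2, e3, Fin.sum_univ_four] at *
  linear_combination E

end SpinFrame

open Complex (I)

lemma eta_zero : eta 0 0 = 1 := by simp [eta]

lemma eta_one : eta 1 1 = -1 := by simp [eta]

lemma eta_two : eta 2 2 = -1 := by simp [eta]

lemma eta_three : eta 3 3 = -1 := by simp [eta]

/-- The three complex components of the part of a skew matrix that acts on unprimed spinors. -/
def selfDual (W : Fin 4 → Fin 4 → ℝ) : Fin 3 → ℂ :=
  ![W 0 1 + I * W 2 3, W 0 2 + I * W 3 1, W 0 3 + I * W 1 2]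

/-- The algebraic symmetries of a Riemann tensor at a point. -/
structure IsCurvature (R : Fin 4 → Fin 4 → Fin 4 → Fin 4 → ℝ) : Prop where
  swap_left : ∀ a b c d, R a b c d = - R b a c d
  swap_right : ∀ a b c d, R a b c d = - R a b d c
  cyclic : ∀ a b c d, R a b c d + R b c a d + R c a b d = 0

namespace IsCurvature

variable {R : Fin 4 → Fin 4 → Fin 4 → Fin 4 → ℝ}

lemma pair_swap (h : IsCurvature R) (a b c d : Fin 4) : R a b c d = R c d a b := by
  linarith [h.cyclic a b c d, h.cyclic b c d a, h.cyclic c d a b, h.cyclic d a b c,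
    h.swap_left a b c d, h.swap_right a b c d, h.swap_left c d a b, h.swap_right c d a b,
    h.swap_right b c a d, h.swap_right c a b d, h.swap_left c a b d, h.swap_right c d b a,
    h.swap_right d b c a, h.swap_left d b c a, h.swap_right b d c a, h.swap_left a c d b,
    h.swap_right a c d b, h.swap_right a c b d, h.swap_right d a b c, h.swap_left d a b c,
    h.swap_right a d b c, h.swap_left b d a c, h.swap_right b d a c, h.swap_left b c d a,
    h.swap_left a b d c, h.swap_right d a c b, h.swap_left d a c b]

lemma diag_left (h : IsCurvature R) (a c d : Fin 4) : R a a c d = 0 := by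
  linarith [h.swap_left a a c d]

lemma diag_right (h : IsCurvature R) (a b c : Fin 4) : R a b c c = 0 := by
  linarith [h.swap_right a b c c]

/-- The components of an Einstein curvature tensor. -/
lemma einstein_components (h : IsCurvature R) {s : ℝ}
    (hE : ∀ a b, ∑ c, R a c b c * eta c c = s * eta a b) :
    (R 2 3 2 3 = - R 0 1 0 1 ∧ R 1 3 1 3 = - R 0 2 0 2 ∧ R 1 2 1 2 = - R 0 3 0 3) ∧
    (R 1 3 2 3 = R 0 1 0 2 ∧ R 1 2 2 3 = - R 0 1 0 3 ∧ R 1 2 1 3 = R 0 2 0 3) ∧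
    (R 0 1 1 3 = - R 0 2 2 3 ∧ R 0 1 1 2 = R 0 3 2 3 ∧ R 0 2 1 2 = - R 0 3 1 3) ∧
    (R 0 1 2 3 - R 0 2 1 3 + R 0 3 1 2 = 0 ∧ R 0 1 0 1 + R 0 2 0 2 + R 0 3 0 3 = - s) := by
  have l10 := h.swap_left 1 0
  have l20 := h.swap_left 2 0
  have l30 := h.swap_left 3 0
  have l21 := h.swap_left 2 1
  have l31 := h.swap_left 3 1
  have l32 := h.swap_left 3 2
  have r10 := fun a b ↦ h.swap_right a b 1 0
  have r20 := fun a b ↦ h.swap_right a b 2 0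
  have r30 := fun a b ↦ h.swap_right a b 3 0
  have r21 := fun a b ↦ h.swap_right a b 2 1
  have r31 := fun a b ↦ h.swap_right a b 3 1
  have r32 := fun a b ↦ h.swap_right a b 3 2
  have p1 := h.pair_swap 1 3 2 3
  have p2 := h.pair_swap 1 2 2 3
  have p3 := h.pair_swap 1 2 1 3
  have p4 := h.pair_swap 0 1 0 2
  have p5 := h.pair_swap 0 1 0 3
  have p6 := h.pair_swap 0 2 0 3
  have p7 := h.pair_swap 0 1 1 2
  have p8 := h.pair_swap 0 1 1 3
  have p9 := h.pair_swap 0 2 1 2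
  have p10 := h.pair_swap 0 2 2 3
  have p11 := h.pair_swap 0 3 1 3
  have p12 := h.pair_swap 0 3 2 3
  have p13 := h.pair_swap 0 3 1 2
  have cyc := h.cyclic 0 1 2 3
  have e00 := hE 0 0
  have e11 := hE 1 1
  have e22 := hE 2 2
  have e33 := hE 3 3
  have e01 := hE 0 1
  have e02 := hE 0 2
  have e03 := hE 0 3
  have e12 := hE 1 2
  have e13 := hE 1 3
  have e23 := hE 2 3
  have n01 : eta 0 1 = 0 := eta_of_ne (by decide)
  have n02 : eta 0 2 = 0 := eta_of_ne (by decide)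
  have n03 : eta 0 3 = 0 := eta_of_ne (by decide)
  have n12 : eta 1 2 = 0 := eta_of_ne (by decide)
  have n13 : eta 1 3 = 0 := eta_of_ne (by decide)
  have n23 : eta 2 3 = 0 := eta_of_ne (by decide)
  norm_num [Fin.sum_univ_four, eta_zero, eta_one, eta_two, eta_three, n01, n02, n03, n12, n13, n23,
    h.diag_left, h.diag_right, l10, l20, l30, l21, l31, l32, r10,
    r20, r30, r21, r31, r32] at e00 e11 e22 e33 e01 e02 e03 e12 e13 e23 cyc
  refine ⟨⟨?_, ?_, ?_⟩, ⟨?_, ?_, ?_⟩, ⟨?_, ?_, ?_⟩, ?_, ?_⟩ <;> linarith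

/-- For an Einstein curvature tensor the left and the right dual agree. -/
lemma duality (h : IsCurvature R) {s : ℝ}
    (hE : ∀ a b, ∑ c, R a c b c * eta c c = s * eta a b) (k : Fin 3) :
    selfDual (R 2 3) k = - I * selfDual (R 0 1) k ∧ selfDual (R 3 1) k = - I * selfDual (R 0 2) k ∧
      selfDual (R 1 2) k = - I * selfDual (R 0 3) k := by
  obtain ⟨⟨a1, a2, a3⟩, ⟨b1, b2, b3⟩, ⟨c1, c2, c3⟩, -, -⟩ := h.einstein_components hE
  have q := h.pair_swap
  have l31 := h.swap_left 3 1
  have r31 := fun a b ↦ h.swap_right a b 3 1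
  refine ⟨?_, ?_, ?_⟩ <;> fin_cases k <;>
    simp [selfDual, l31, r31, q 2 3 0 1, q 2 3 0 2, q 2 3 0 3, q 1 3 0 1, q 1 3 0 2, q 1 3 0 3,
      q 1 2 0 1, q 1 2 0 2, q 1 2 0 3, q 2 3 1 3, q 2 3 1 2, q 1 3 1 2, a1, a2, a3, b1, b2, b3,
      c1, c2, c3, q 0 2 0 1, q 0 3 0 1, q 0 3 0 2] <;> ring_nf <;> simp

lemma selfDual_symm_trace (h : IsCurvature R) {s : ℝ}
    (hE : ∀ a b, ∑ c, R a c b c * eta c c = s * eta a b) :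
    selfDual (R 0 2) 0 = selfDual (R 0 1) 1 ∧ selfDual (R 0 3) 0 = selfDual (R 0 1) 2 ∧
      selfDual (R 0 3) 1 = selfDual (R 0 2) 2 ∧
      selfDual (R 0 1) 0 + selfDual (R 0 2) 1 + selfDual (R 0 3) 2 = - s := by
  obtain ⟨-, -, ⟨c1, c2, c3⟩, t1, t2⟩ := h.einstein_components hE
  have q := h.pair_swap
  have r31 := fun a b ↦ h.swap_right a b 3 1
  refine ⟨?_, ?_, ?_, ?_⟩
  · simp [selfDual, r31, c1, q 0 2 0 1]
  · simp [selfDual, c2, q 0 3 0 1]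
  · simp [selfDual, r31, c3, q 0 3 0 2]
  · have t1' := congrArg (fun r : ℝ ↦ (r : ℂ)) t1
    have t2' := congrArg (fun r : ℝ ↦ (r : ℂ)) t2
    simp [selfDual, r31] at *
    linear_combination t2' + I * t1'

end IsCurvature

namespace SpinFrame

variable {M : Type*} [TopologicalSpace M] [ChartedSpace E4 M] [IsManifold (𝓡 4) ∞ M]
  {g : LorentzMetric M} (F : SpinFrame g)

lemma isCurvature_riemann (x : M) : IsCurvature (fun a b c d ↦ F.riemann a b c d x) :=
  ⟨fun a b c d ↦ F.riemann_swap_left a b c d x, fun a b c d ↦ F.riemann_swap_right a b c d x,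
    fun a b c d ↦ F.riemann_cyclic a b c d x⟩

/-- The unprimed part of the Levi-Civita connection. -/
def sdConn (k : Fin 3) (a : Fin 4) (x : M) : ℂ := selfDual (fun b c ↦ F.conn a b c x) k

/-- The curvature of the unprimed part of the Levi-Civita connection. -/
def sdCurv (k : Fin 3) (a b : Fin 4) (x : M) : ℂ := selfDual (fun c d ↦ F.riemann a b c d x) k

lemma isSmooth_selfDual {W : Fin 4 → Fin 4 → M → ℝ}
    (hW : ∀ a b, ContMDiff (𝓡 4) 𝓘(ℝ, ℝ) ∞ (W a b)) (k : Fin 3) :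
    IsSmooth (fun x ↦ selfDual (fun a b ↦ W a b x) k) := by
  have h : ∀ a b c d, IsSmooth (fun x ↦ (W a b x : ℂ) + I * (W c d x : ℂ)) := fun a b c d ↦
    (isSmooth_ofReal (hW a b)).fadd ((isSmooth_const I).fmul (isSmooth_ofReal (hW c d)))
  fin_cases k <;> exact h _ _ _ _

lemma isSmooth_sdConn (k : Fin 3) (a : Fin 4) : IsSmooth (F.sdConn k a) :=
  isSmooth_selfDual (F.contMDiff_conn a) k

lemma isSmooth_sdCurv (k : Fin 3) (a b : Fin 4) : IsSmooth (F.sdCurv k a b) :=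
  isSmooth_selfDual (F.contMDiff_riemann a b) k

lemma dC_sdConn (k : Fin 3) (e a : Fin 4) (x : M) :
    F.dC e (F.sdConn k a) x = selfDual (fun b c ↦ F.dR e (F.conn a b c) x) k := by
  have h : ∀ b c b' c', F.dC e (fun x ↦ (F.conn a b c x : ℂ) + I * (F.conn a b' c' x : ℂ)) x
      = (F.dR e (F.conn a b c) x : ℂ) + I * (F.dR e (F.conn a b' c') x : ℂ) := by
    intro b c b' c'
    have s := fun b c ↦ isSmooth_ofReal (F.contMDiff_conn a b c)
    rw [F.dC_add e ((s b c).mdiff x) (((isSmooth_const I).fmul (s b' c')).mdiff x),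
      F.dC_const_mul e _ ((s b' c').mdiff x), F.dC_ofReal e (F.mdiff_conn _ _ _ x),
      F.dC_ofReal e (F.mdiff_conn _ _ _ x)]
  fin_cases k <;> exact h _ _ _ _

lemma conn_diag (a b : Fin 4) (x : M) : F.conn a b b x = 0 := by
  linarith [F.conn_swap a b b x]

lemma sdCurv_eq (a b : Fin 4) (x : M) :
    F.sdCurv 0 a b x = F.extD (F.sdConn 0) a b x
      + I * (F.sdConn 1 a x * F.sdConn 2 b x - F.sdConn 2 a x * F.sdConn 1 b x) ∧
    F.sdCurv 1 a b x = F.extD (F.sdConn 1) a b x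
      + I * (F.sdConn 2 a x * F.sdConn 0 b x - F.sdConn 0 a x * F.sdConn 2 b x) ∧
    F.sdCurv 2 a b x = F.extD (F.sdConn 2) a b x
      + I * (F.sdConn 0 a x * F.sdConn 1 b x - F.sdConn 1 a x * F.sdConn 0 b x) := by
  have w10 := fun a ↦ F.conn_swap a 1 0 x
  have w20 := fun a ↦ F.conn_swap a 2 0 x
  have w30 := fun a ↦ F.conn_swap a 3 0 x
  have w21 := fun a ↦ F.conn_swap a 2 1 x
  have w13 := fun a ↦ F.conn_swap a 1 3 x
  have w32 := fun a ↦ F.conn_swap a 3 2 x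
  simp only [extD, dC_sdConn, sdCurv, sdConn, selfDual, riemann_eq, Fin.sum_univ_four, struct,
    bracketUp_eq, Matrix.cons_val_zero, Matrix.cons_val_one, Matrix.cons_val, w10, w20, w30, w21,
    w13, w32, conn_diag, eta_zero, eta_one, eta_two, eta_three]
  push_cast
  refine ⟨?_, ?_, ?_⟩
  · linear_combination (-I) * (F.conn a 3 1 x * F.conn b 1 2 x - F.conn a 1 2 x * F.conn b 3 1 x)
      * Complex.I_sq + (F.conn b 0 2 x * F.conn a 1 2 x - F.conn a 0 2 x * F.conn b 1 2 x
        - F.conn b 0 3 x * F.conn a 3 1 x + F.conn a 0 3 x * F.conn b 3 1 x) * Complex.I_sq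
  · linear_combination (-I) * (F.conn a 1 2 x * F.conn b 2 3 x - F.conn a 2 3 x * F.conn b 1 2 x)
      * Complex.I_sq + (F.conn a 0 1 x * F.conn b 1 2 x - F.conn b 0 1 x * F.conn a 1 2 x
        + F.conn b 0 3 x * F.conn a 2 3 x - F.conn a 0 3 x * F.conn b 2 3 x) * Complex.I_sq
  · linear_combination (-I) * (F.conn a 2 3 x * F.conn b 3 1 x - F.conn a 3 1 x * F.conn b 2 3 x)
      * Complex.I_sq + (F.conn b 0 1 x * F.conn a 3 1 x - F.conn a 0 1 x * F.conn b 3 1 x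
        - F.conn b 0 2 x * F.conn a 2 3 x + F.conn a 0 2 x * F.conn b 2 3 x) * Complex.I_sq

end SpinFrame

lemma sum_perm_fin_four {β : Type*} [AddCommMonoid β] (f : Fin 4 → Fin 4 → Fin 4 → Fin 4 → β) :
    ∑ π : Equiv.Perm (Fin 4), f (π 0) (π 1) (π 2) (π 3) =
      (f 0 1 2 3 + f 0 1 3 2 + f 0 2 1 3 + f 0 2 3 1 + f 0 3 1 2 + f 0 3 2 1) +
      (f 1 0 2 3 + f 1 0 3 2 + f 1 2 0 3 + f 1 2 3 0 + f 1 3 0 2 + f 1 3 2 0) +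
      (f 2 0 1 3 + f 2 0 3 1 + f 2 1 0 3 + f 2 1 3 0 + f 2 3 0 1 + f 2 3 1 0) +
      (f 3 0 1 2 + f 3 0 2 1 + f 3 1 0 2 + f 3 1 2 0 + f 3 2 0 1 + f 3 2 1 0) := by
  have h : (Finset.univ : Finset (Equiv.Perm (Fin 4))).val.map (fun π ↦ (π 0, π 1, π 2, π 3)) =
      {(0, 1, 2, 3), (0, 1, 3, 2), (0, 2, 1, 3), (0, 2, 3, 1), (0, 3, 1, 2), (0, 3, 2, 1),
        (1, 0, 2, 3), (1, 0, 3, 2), (1, 2, 0, 3), (1, 2, 3, 0), (1, 3, 0, 2), (1, 3, 2, 0),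
        (2, 0, 1, 3), (2, 0, 3, 1), (2, 1, 0, 3), (2, 1, 3, 0), (2, 3, 0, 1), (2, 3, 1, 0),
        (3, 0, 1, 2), (3, 0, 2, 1), (3, 1, 0, 2), (3, 1, 2, 0), (3, 2, 0, 1), (3, 2, 1, 0)} := by
    decide
  have h2 := congrArg (fun m ↦ (m.map (fun q ↦ f q.1 q.2.1 q.2.2.1 q.2.2.2)).sum) h
  simp only [Multiset.map_map, Function.comp_def] at h2
  refine h2.trans ?_
  simp only [Multiset.insert_eq_cons, Multiset.map_cons, Multiset.map_singleton, Multiset.sum_cons,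
    Multiset.sum_singleton]
  abel

lemma eps_zero_zero : eps 0 0 = 0 := by simp [eps]

lemma eps_zero_one : eps 0 1 = 1 := by simp [eps]

lemma eps_one_zero : eps 1 0 = -1 := by simp [eps]

lemma eps_one_one : eps 1 1 = 0 := by simp [eps]

lemma inv_sqrt_two_mul_self :
    ((Real.sqrt 2 : ℝ) : ℂ)⁻¹ * ((Real.sqrt 2 : ℝ) : ℂ)⁻¹ = 1 / 2 := by
  rw [← mul_inv, ← Complex.ofReal_mul, Real.mul_self_sqrt (by norm_num)]
  norm_num

/-- The unprimed spinor part `½ ε^{B'C'} W_{BB'CC'}` of a two-index tensor. -/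
def spinProj (W : Fin 4 → Fin 4 → ℂ) (B C : Fin 2) : ℂ :=
  (1 / 2 : ℂ) * ∑ B', ∑ C', eps B' C' * ∑ b, ∑ c, solder b B B' * solder c C C' * W b c

lemma spinProj_of_skew {W : Fin 4 → Fin 4 → ℂ} (hW : ∀ a b, W a b = - W b a) :
    spinProj W 0 0 = (1 / 2) * (W 0 1 - I * W 0 2 + W 3 1 + I * W 2 3) ∧
    spinProj W 0 1 = - (1 / 2) * (W 0 3 + I * W 1 2) ∧
    spinProj W 1 0 = - (1 / 2) * (W 0 3 + I * W 1 2) ∧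
    spinProj W 1 1 = - (1 / 2) * (W 0 1 + I * W 0 2 - W 3 1 + I * W 2 3) := by
  have hd : ∀ a, W a a = 0 := fun a ↦ by
    have := hW a a
    linear_combination (1 / 2) * this
  have hr := inv_sqrt_two_mul_self
  have w10 := hW 1 0
  have w20 := hW 2 0
  have w30 := hW 3 0
  have w21 := hW 2 1
  have w13 := hW 1 3
  have w32 := hW 3 2
  simp only [spinProj, solder, pauli, Fin.sum_univ_two, Fin.sum_univ_four, eps_zero_zero,
    eps_zero_one, eps_one_zero, eps_one_one, hd, w10, w20, w30, w21, w13, w32, Matrix.of_apply,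
    Matrix.cons_val_zero, Matrix.cons_val_one, Matrix.cons_val, Matrix.cons_val']
  generalize ((Real.sqrt 2 : ℝ) : ℂ)⁻¹ = r at hr
  refine ⟨?_, ?_, ?_, ?_⟩
  · linear_combination (W 0 1 - I * W 0 2 + W 3 1 + I * W 2 3) * hr
  · linear_combination -(W 0 3 + I * W 1 2) * hr
  · linear_combination -(W 0 3 + I * W 1 2) * hr
  · linear_combination -(W 0 1 + I * W 0 2 - W 3 1 + I * W 2 3) * hr

lemma spinProj_ofReal {W : Fin 4 → Fin 4 → ℝ} (hW : ∀ a b, W a b = - W b a) :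
    spinProj (fun a b ↦ (W a b : ℂ)) 0 0 = (1 / 2) * (selfDual W 0 - I * selfDual W 1) ∧
    spinProj (fun a b ↦ (W a b : ℂ)) 0 1 = - (1 / 2) * selfDual W 2 ∧
    spinProj (fun a b ↦ (W a b : ℂ)) 1 0 = - (1 / 2) * selfDual W 2 ∧
    spinProj (fun a b ↦ (W a b : ℂ)) 1 1 = - (1 / 2) * (selfDual W 0 + I * selfDual W 1) := by
  have h : ∀ a b, (fun a b ↦ (W a b : ℂ)) a b = - (fun a b ↦ (W a b : ℂ)) b a := fun a b ↦ by
    simp only [hW a b, Complex.ofReal_neg]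
  obtain ⟨h0, h1, h2, h3⟩ := spinProj_of_skew h
  simp only [selfDual, Matrix.cons_val_zero, Matrix.cons_val_one, Matrix.cons_val]
  refine ⟨h0.trans ?_, h1, h2, h3.trans ?_⟩
  · linear_combination (1 / 2) * (W 3 1 : ℂ) * Complex.I_sq
  · linear_combination (1 / 2) * (W 3 1 : ℂ) * Complex.I_sq

namespace SpinFrame

variable {M : Type*} [TopologicalSpace M] [ChartedSpace E4 M] [IsManifold (𝓡 4) ∞ M]
  {g : LorentzMetric M} (F : SpinFrame g)

lemma spinConn_eq (a : Fin 4) (x : M) :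
    F.spinConn a 0 0 x = (1 / 2) * (F.sdConn 0 a x - I * F.sdConn 1 a x) ∧
    F.spinConn a 0 1 x = - (1 / 2) * F.sdConn 2 a x ∧
    F.spinConn a 1 0 x = - (1 / 2) * F.sdConn 2 a x ∧
    F.spinConn a 1 1 x = - (1 / 2) * (F.sdConn 0 a x + I * F.sdConn 1 a x) :=
  spinProj_ofReal fun b c ↦ F.conn_swap a b c x

lemma curvatureSpinor_eq_spinProj (A B C D : Fin 2) (x : M) :
    F.curvatureSpinor A B C D x =
      spinProj (fun a b ↦ spinProj (fun c d ↦ (F.riemann a b c d x : ℂ)) C D) A B := by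
  simp only [curvatureSpinor, riemannSpinor, spinProj, Fin.sum_univ_two, eps_zero_zero,
    eps_zero_one, eps_one_zero, eps_one_one, Finset.mul_sum, ← Finset.sum_add_distrib]
  refine Finset.sum_congr rfl fun a _ ↦ Finset.sum_congr rfl fun b _ ↦
    Finset.sum_congr rfl fun c _ ↦ Finset.sum_congr rfl fun d _ ↦ ?_
  ring

lemma einstein_ricci {Λ : ℝ} (h : ∀ x a b, F.ricci a b x - F.scalarCurvature x / 4 * eta a b = 0)
    (hΛ : ∀ x, F.scalarCurvature x / 24 = Λ) (x : M) (a b : Fin 4) :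
    ∑ c, F.riemann a c b c x * eta c c = 6 * Λ * eta a b := by
  rw [← F.ricci_eq, ← hΛ x]
  linear_combination h x a b

/-- The hypothesis that the Einstein equations hold, in the form that is used below. -/
def EinsteinWith (Λ : ℝ) : Prop :=
  ∀ x a b, ∑ c, F.riemann a c b c x * eta c c = 6 * Λ * eta a b

lemma IsEinstein.exists_einsteinWith {F : SpinFrame g} (h : F.IsEinstein) :
    ∃ Λ, F.EinsteinWith Λ := by
  obtain ⟨h, Λ, hΛ⟩ := h
  exact ⟨Λ, fun x a b ↦ F.einstein_ricci h hΛ x a b⟩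

lemma sdCurv_swap (k : Fin 3) (a b : Fin 4) (x : M) : F.sdCurv k a b x = - F.sdCurv k b a x := by
  have h := fun c d ↦ F.riemann_swap_left a b c d x
  fin_cases k <;> simp [sdCurv, selfDual, h] <;> ring

variable {F} {Λ : ℝ}

lemma EinsteinWith.duality (hE : F.EinsteinWith Λ) (k : Fin 3) (x : M) :
    F.sdCurv k 2 3 x = - I * F.sdCurv k 0 1 x ∧ F.sdCurv k 3 1 x = - I * F.sdCurv k 0 2 x ∧
      F.sdCurv k 1 2 x = - I * F.sdCurv k 0 3 x :=
  (F.isCurvature_riemann x).duality (hE x) k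

lemma EinsteinWith.symm_trace (hE : F.EinsteinWith Λ) (x : M) :
    F.sdCurv 0 0 2 x = F.sdCurv 1 0 1 x ∧ F.sdCurv 0 0 3 x = F.sdCurv 2 0 1 x ∧
      F.sdCurv 1 0 3 x = F.sdCurv 2 0 2 x ∧
      F.sdCurv 0 0 1 x = - (6 * Λ : ℝ) - F.sdCurv 1 0 2 x - F.sdCurv 2 0 3 x := by
  obtain ⟨h1, h2, h3, h4⟩ := (F.isCurvature_riemann x).selfDual_symm_trace (hE x)
  refine ⟨h1, h2, h3, ?_⟩
  simp only [sdCurv]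
  linear_combination h4

lemma EinsteinWith.spinProj_sdCurv (hE : F.EinsteinWith Λ) (k : Fin 3) (x : M) :
    spinProj (fun a b ↦ F.sdCurv k a b x) 0 0 = F.sdCurv k 0 1 x - I * F.sdCurv k 0 2 x ∧
    spinProj (fun a b ↦ F.sdCurv k a b x) 0 1 = - F.sdCurv k 0 3 x ∧
    spinProj (fun a b ↦ F.sdCurv k a b x) 1 0 = - F.sdCurv k 0 3 x ∧
    spinProj (fun a b ↦ F.sdCurv k a b x) 1 1 = - (F.sdCurv k 0 1 x + I * F.sdCurv k 0 2 x) := by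
  obtain ⟨h0, h1, h2, h3⟩ := spinProj_of_skew (fun a b ↦ F.sdCurv_swap k a b x)
  obtain ⟨d1, d2, d3⟩ := hE.duality k x
  rw [h0, h1, h2, h3, d1, d2, d3]
  refine ⟨?_, ?_, ?_, ?_⟩
  · linear_combination - (1 / 2) * F.sdCurv k 0 1 x * Complex.I_sq
  · linear_combination (1 / 2) * F.sdCurv k 0 3 x * Complex.I_sq
  · linear_combination (1 / 2) * F.sdCurv k 0 3 x * Complex.I_sq
  · linear_combination (1 / 2) * F.sdCurv k 0 1 x * Complex.I_sq

lemma spinProj_linear (c₁ c₂ : ℂ) (V W : Fin 4 → Fin 4 → ℂ) (B C : Fin 2) :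
    spinProj (fun a b ↦ c₁ * V a b + c₂ * W a b) B C = c₁ * spinProj V B C + c₂ * spinProj W B C := by
  simp only [spinProj, Fin.sum_univ_two, Finset.mul_sum, ← Finset.sum_add_distrib]
  refine Finset.sum_congr rfl fun a _ ↦ Finset.sum_congr rfl fun b _ ↦ ?_
  ring

lemma curvatureSpinor_eq (A B : Fin 2) (x : M) :
    F.curvatureSpinor A B 0 0 x = (1 / 2) * spinProj (fun a b ↦ F.sdCurv 0 a b x) A B
      + - (I / 2) * spinProj (fun a b ↦ F.sdCurv 1 a b x) A B ∧
    F.curvatureSpinor A B 0 1 x = - (1 / 2) * spinProj (fun a b ↦ F.sdCurv 2 a b x) A B ∧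
    F.curvatureSpinor A B 1 0 x = - (1 / 2) * spinProj (fun a b ↦ F.sdCurv 2 a b x) A B ∧
    F.curvatureSpinor A B 1 1 x = - (1 / 2) * spinProj (fun a b ↦ F.sdCurv 0 a b x) A B
      + - (I / 2) * spinProj (fun a b ↦ F.sdCurv 1 a b x) A B := by
  have h := fun a b ↦ spinProj_ofReal fun c d ↦ F.riemann_swap_right a b c d x
  simp only [curvatureSpinor_eq_spinProj, (h _ _).1, (h _ _).2.1, (h _ _).2.2.1, (h _ _).2.2.2]
  refine ⟨?_, ?_, ?_, ?_⟩
  · rw [← spinProj_linear]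
    congr 1; funext a b; simp only [sdCurv]; ring
  · have := spinProj_linear (- (1 / 2)) 0 (fun a b ↦ F.sdCurv 2 a b x) 0 A B
    simpa [sdCurv] using this
  · have := spinProj_linear (- (1 / 2)) 0 (fun a b ↦ F.sdCurv 2 a b x) 0 A B
    simpa [sdCurv] using this
  · rw [← spinProj_linear]
    congr 1; funext a b; simp only [sdCurv]; ring

variable (F) in
/-- The five components of the Weyl spinor, in terms of the self-dual curvature. -/
def weylComp (Λ : ℝ) (n : ℕ) (x : M) : ℂ :=
  match n with
  | 0 => (1 / 2) * (- (6 * Λ : ℝ) - 2 * F.sdCurv 1 0 2 x - F.sdCurv 2 0 3 x) - I * F.sdCurv 1 0 1 x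
  | 1 => - (1 / 2) * (F.sdCurv 2 0 1 x - I * F.sdCurv 2 0 2 x)
  | 2 => (1 / 2) * F.sdCurv 2 0 3 x + (Λ : ℂ)
  | 3 => (1 / 2) * (F.sdCurv 2 0 1 x + I * F.sdCurv 2 0 2 x)
  | 4 => (1 / 2) * (- (6 * Λ : ℝ) - 2 * F.sdCurv 1 0 2 x - F.sdCurv 2 0 3 x) + I * F.sdCurv 1 0 1 x
  | _ => 0

lemma EinsteinWith.weyl_eq (hE : F.EinsteinWith Λ) (A B C D : Fin 2) (x : M) :
    F.weyl A B C D x = F.weylComp Λ ((A : ℕ) + B + C + D) x := by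
  obtain ⟨s1, s2, s3, s4⟩ := hE.symm_trace x
  have p := fun k ↦ hE.spinProj_sdCurv k x
  rw [weyl, sum_perm_fin_four (fun i j k l ↦ F.curvatureSpinor (![A, B, C, D] i) (![A, B, C, D] j)
    (![A, B, C, D] k) (![A, B, C, D] l) x)]
  fin_cases A <;> fin_cases B <;> fin_cases C <;> fin_cases D <;>
  · simp only [Matrix.cons_val_zero, Matrix.cons_val_one, Matrix.cons_val, Fin.zero_eta, Fin.mk_one,
      Fin.isValue, (curvatureSpinor_eq _ _ _).1,
      (curvatureSpinor_eq _ _ _).2.1, (curvatureSpinor_eq _ _ _).2.2.1,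
      (curvatureSpinor_eq _ _ _).2.2.2, (p _).1, (p _).2.1, (p _).2.2.1, (p _).2.2.2, weylComp,
      s1, s2, s3, s4]
    push_cast
    ring_nf <;> simp only [Complex.I_sq] <;> ring

end SpinFrame

namespace SpinFrame

variable {M : Type*} [TopologicalSpace M] [ChartedSpace E4 M] [IsManifold (𝓡 4) ∞ M]
  {g : LorentzMetric M} {F : SpinFrame g} {Λ : ℝ}

variable (F) in
/-- The left-hand side of the second Bianchi identity for the self-dual curvature, where `k`, `l`,
`m` is a cyclic permutation of the three components. -/
def bianchiSum (k l m : Fin 3) (a b c : Fin 4) (x : M) : ℂ :=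
  F.dC a (F.sdCurv k b c) x + F.dC b (F.sdCurv k c a) x + F.dC c (F.sdCurv k a b) x
    + I * (F.sdConn l a x * F.sdCurv m b c x - F.sdConn m a x * F.sdCurv l b c x
      + (F.sdConn l b x * F.sdCurv m c a x - F.sdConn m b x * F.sdCurv l c a x)
      + (F.sdConn l c x * F.sdCurv m a b x - F.sdConn m c x * F.sdCurv l a b x))
    + ∑ e, (F.struct b c e x * F.sdCurv k a e x + F.struct c a e x * F.sdCurv k b e x
      + F.struct a b e x * F.sdCurv k c e x)

variable (F) in
lemma bianchiSum_eq_zero (a b c : Fin 4) (x : M) :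
    F.bianchiSum 0 1 2 a b c x = 0 ∧ F.bianchiSum 1 2 0 a b c x = 0 ∧
      F.bianchiSum 2 0 1 a b c x = 0 := by
  have s := F.isSmooth_sdConn
  have h := F.sdCurv_eq
  exact ⟨F.bianchi_component (s 0) (s 1) (s 2) (fun a b x ↦ (h a b x).1) (fun a b x ↦ (h a b x).2.1)
      (fun a b x ↦ (h a b x).2.2) a b c x,
    F.bianchi_component (s 1) (s 2) (s 0) (fun a b x ↦ (h a b x).2.1) (fun a b x ↦ (h a b x).2.2)
      (fun a b x ↦ (h a b x).1) a b c x,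
    F.bianchi_component (s 2) (s 0) (s 1) (fun a b x ↦ (h a b x).2.2) (fun a b x ↦ (h a b x).1)
      (fun a b x ↦ (h a b x).2.1) a b c x⟩

variable (F) in
/-- `∇_e Ψ_n`, the tetrad derivative of the component of the Weyl spinor with `n` indices equal
to `1`. -/
def covWeyl (Λ : ℝ) (e : Fin 4) (n : ℕ) (x : M) : ℂ :=
  F.dC e (F.weylComp Λ n) x
    - (4 - n) * (F.spinConn e 0 1 x * F.weylComp Λ n x - F.spinConn e 0 0 x * F.weylComp Λ (n + 1) x)
    - n * (F.spinConn e 1 1 x * F.weylComp Λ (n - 1) x - F.spinConn e 0 1 x * F.weylComp Λ n x)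

lemma dC_affine (e : Fin 4) (c₀ c₁ c₂ : ℂ) {f h : M → ℂ} (hf : IsSmooth f) (hh : IsSmooth h)
    (x : M) : F.dC e (fun y ↦ c₀ + c₁ * f y + c₂ * h y) x = c₁ * F.dC e f x + c₂ * F.dC e h x := by
  have h1 := (isSmooth_const c₁).fmul hf
  have h2 := (isSmooth_const c₂).fmul hh
  rw [F.dC_add e (((isSmooth_const c₀).fadd h1).mdiff x) (h2.mdiff x),
    F.dC_add e ((isSmooth_const c₀).mdiff x) (h1.mdiff x), F.dC_const,
    F.dC_const_mul e c₁ (hf.mdiff x), F.dC_const_mul e c₂ (hh.mdiff x), zero_add]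

lemma EinsteinWith.dC_sdCurv (hE : F.EinsteinWith Λ) (e : Fin 4) (k : Fin 3) (x : M) :
    F.dC e (F.sdCurv k 2 3) x = - I * F.dC e (F.sdCurv k 0 1) x ∧
    F.dC e (F.sdCurv k 3 1) x = - I * F.dC e (F.sdCurv k 0 2) x ∧
    F.dC e (F.sdCurv k 1 2) x = - I * F.dC e (F.sdCurv k 0 3) x := by
  have s := fun j ↦ (F.isSmooth_sdCurv k 0 j).mdiff x
  rw [← F.dC_const_mul e _ (s 1), ← F.dC_const_mul e _ (s 2), ← F.dC_const_mul e _ (s 3),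
    funext fun y ↦ (hE.duality k y).1, funext fun y ↦ (hE.duality k y).2.1,
    funext fun y ↦ (hE.duality k y).2.2]
  exact ⟨rfl, rfl, rfl⟩

variable (F) in
lemma dC_sdCurv_swap (e : Fin 4) (k : Fin 3) (a b : Fin 4) (x : M) :
    F.dC e (F.sdCurv k a b) x = - F.dC e (F.sdCurv k b a) x := by
  rw [funext (F.sdCurv_swap k a b), ← neg_one_mul,
    ← F.dC_const_mul e _ ((F.isSmooth_sdCurv k b a).mdiff x)]
  simp only [neg_one_mul]

lemma EinsteinWith.dC_symm_trace (hE : F.EinsteinWith Λ) (e : Fin 4) (x : M) :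
    F.dC e (F.sdCurv 0 0 2) x = F.dC e (F.sdCurv 1 0 1) x ∧
    F.dC e (F.sdCurv 0 0 3) x = F.dC e (F.sdCurv 2 0 1) x ∧
    F.dC e (F.sdCurv 1 0 3) x = F.dC e (F.sdCurv 2 0 2) x ∧
    F.dC e (F.sdCurv 0 0 1) x = - F.dC e (F.sdCurv 1 0 2) x - F.dC e (F.sdCurv 2 0 3) x := by
  have h := hE.symm_trace
  rw [funext fun y ↦ (h y).1, funext fun y ↦ (h y).2.1, funext fun y ↦ (h y).2.2.1]
  refine ⟨rfl, rfl, rfl, ?_⟩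
  have := F.dC_affine e (-((6 * Λ : ℝ) : ℂ)) (-1) (-1) (F.isSmooth_sdCurv 1 0 2)
    (F.isSmooth_sdCurv 2 0 3) x
  rw [show F.sdCurv 0 0 1 = fun y ↦ -((6 * Λ : ℝ) : ℂ) + -1 * F.sdCurv 1 0 2 y
    + -1 * F.sdCurv 2 0 3 y from funext fun y ↦ by rw [(h y).2.2.2]; ring, this]
  ring

variable (F) in
lemma isSmooth_weylComp (Λ : ℝ) (n : ℕ) : IsSmooth (F.weylComp Λ n) := by
  have s := F.isSmooth_sdCurv
  have c := isSmooth_const (M := M)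
  match n with
  | 0 =>
    exact ((c _).fmul (((c _).fsub ((c _).fmul (s _ _ _))).fsub (s _ _ _))).fsub
      ((c _).fmul (s _ _ _))
  | 1 => exact (c _).fmul ((s _ _ _).fsub ((c _).fmul (s _ _ _)))
  | 2 => exact ((c _).fmul (s _ _ _)).fadd (c _)
  | 3 => exact (c _).fmul ((s _ _ _).fadd ((c _).fmul (s _ _ _)))
  | 4 =>
    exact ((c _).fmul (((c _).fsub ((c _).fmul (s _ _ _))).fsub (s _ _ _))).fadd
      ((c _).fmul (s _ _ _))
  | _ + 5 => exact c 0

variable (F) in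
lemma dC_weylComp (Λ : ℝ) (e : Fin 4) (x : M) :
    F.dC e (F.weylComp Λ 0) x = - F.dC e (F.sdCurv 1 0 2) x - (1 / 2) * F.dC e (F.sdCurv 2 0 3) x
      - I * F.dC e (F.sdCurv 1 0 1) x ∧
    F.dC e (F.weylComp Λ 1) x
      = - (1 / 2) * F.dC e (F.sdCurv 2 0 1) x + I / 2 * F.dC e (F.sdCurv 2 0 2) x ∧
    F.dC e (F.weylComp Λ 2) x = (1 / 2) * F.dC e (F.sdCurv 2 0 3) x ∧
    F.dC e (F.weylComp Λ 3) x
      = (1 / 2) * F.dC e (F.sdCurv 2 0 1) x + I / 2 * F.dC e (F.sdCurv 2 0 2) x ∧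
    F.dC e (F.weylComp Λ 4) x = - F.dC e (F.sdCurv 1 0 2) x - (1 / 2) * F.dC e (F.sdCurv 2 0 3) x
      + I * F.dC e (F.sdCurv 1 0 1) x := by
  have s := F.isSmooth_sdCurv
  have c := isSmooth_const (M := M)
  have d2 := fun c₀ c₁ c₂ k a b k' a' b' ↦ F.dC_affine e c₀ c₁ c₂ (s k a b) (s k' a' b') x
  refine ⟨?_, ?_, ?_, ?_, ?_⟩
  · rw [show F.weylComp Λ 0 = fun y ↦ ((-3 * Λ : ℂ) + -1 * F.sdCurv 1 0 2 y
        + - (1 / 2) * F.sdCurv 2 0 3 y) - I * F.sdCurv 1 0 1 y from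
          funext fun y ↦ by simp only [weylComp]; push_cast; ring,
      F.dC_sub e ((((c _).fadd ((c _).fmul (s _ _ _))).fadd ((c _).fmul (s _ _ _))).mdiff x)
        (((c _).fmul (s _ _ _)).mdiff x), d2, F.dC_const_mul e _ ((s _ _ _).mdiff x)]
    ring
  · rw [show F.weylComp Λ 1 = fun y ↦ 0 + - (1 / 2) * F.sdCurv 2 0 1 y
        + I / 2 * F.sdCurv 2 0 2 y from funext fun y ↦ by simp only [weylComp]; ring, d2]
  · rw [show F.weylComp Λ 2 = fun y ↦ (Λ : ℂ) + (1 / 2) * F.sdCurv 2 0 3 y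
        + 0 * F.sdCurv 2 0 3 y from funext fun y ↦ by simp only [weylComp]; ring, d2]
    ring
  · rw [show F.weylComp Λ 3 = fun y ↦ 0 + (1 / 2) * F.sdCurv 2 0 1 y
        + I / 2 * F.sdCurv 2 0 2 y from funext fun y ↦ by simp only [weylComp]; ring, d2]
  · rw [show F.weylComp Λ 4 = fun y ↦ ((-3 * Λ : ℂ) + -1 * F.sdCurv 1 0 2 y
        + - (1 / 2) * F.sdCurv 2 0 3 y) + I * F.sdCurv 1 0 1 y from
          funext fun y ↦ by simp only [weylComp]; push_cast; ring,
      F.dC_add e ((((c _).fadd ((c _).fmul (s _ _ _))).fadd ((c _).fmul (s _ _ _))).mdiff x)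
        (((c _).fmul (s _ _ _)).mdiff x), d2, F.dC_const_mul e _ ((s _ _ _).mdiff x)]
    ring

end SpinFrame

namespace SpinFrame

variable {M : Type*} [TopologicalSpace M] [ChartedSpace E4 M] [IsManifold (𝓡 4) ∞ M]
  {g : LorentzMetric M} {F : SpinFrame g} {Λ : ℝ}

/-- The Bianchi identities `∇^{AA'} Ψ_{ABCD} = 0`, in components. -/
lemma EinsteinWith.bianchi (hE : F.EinsteinWith Λ) (x : M) :
    ((F.covWeyl Λ 0 0 x - F.covWeyl Λ 3 0 x) - (F.covWeyl Λ 1 1 x - I * F.covWeyl Λ 2 1 x) = 0 ∧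
    (F.covWeyl Λ 0 1 x - F.covWeyl Λ 3 1 x) - (F.covWeyl Λ 1 2 x - I * F.covWeyl Λ 2 2 x) = 0 ∧
    (F.covWeyl Λ 0 2 x - F.covWeyl Λ 3 2 x) - (F.covWeyl Λ 1 3 x - I * F.covWeyl Λ 2 3 x) = 0 ∧
    (F.covWeyl Λ 0 3 x - F.covWeyl Λ 3 3 x) - (F.covWeyl Λ 1 4 x - I * F.covWeyl Λ 2 4 x) = 0) ∧
    (F.covWeyl Λ 1 0 x + I * F.covWeyl Λ 2 0 x) - (F.covWeyl Λ 0 1 x + F.covWeyl Λ 3 1 x) = 0 ∧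
    (F.covWeyl Λ 1 1 x + I * F.covWeyl Λ 2 1 x) - (F.covWeyl Λ 0 2 x + F.covWeyl Λ 3 2 x) = 0 ∧
    (F.covWeyl Λ 1 2 x + I * F.covWeyl Λ 2 2 x) - (F.covWeyl Λ 0 3 x + F.covWeyl Λ 3 3 x) = 0 ∧
    (F.covWeyl Λ 1 3 x + I * F.covWeyl Λ 2 3 x) - (F.covWeyl Λ 0 4 x + F.covWeyl Λ 3 4 x) = 0 := by
  obtain ⟨q1, q2, q3, q4⟩ := hE.symm_trace x
  have h0 := fun k ↦ (hE.duality k x).1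
  have h1 := fun k ↦ (hE.duality k x).2.1
  have h2 := fun k ↦ (hE.duality k x).2.2
  have d0 := fun e k ↦ (hE.dC_sdCurv e k x).1
  have d1 := fun e k ↦ (hE.dC_sdCurv e k x).2.1
  have d2 := fun e k ↦ (hE.dC_sdCurv e k x).2.2
  have t1 := fun e ↦ (hE.dC_symm_trace e x).1
  have t2 := fun e ↦ (hE.dC_symm_trace e x).2.1
  have t3 := fun e ↦ (hE.dC_symm_trace e x).2.2.1
  have t4 := fun e ↦ (hE.dC_symm_trace e x).2.2.2
  have f10 := fun k ↦ F.sdCurv_swap k 1 0 x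
  have f20 := fun k ↦ F.sdCurv_swap k 2 0 x
  have f30 := fun k ↦ F.sdCurv_swap k 3 0 x
  have f21 := fun k ↦ F.sdCurv_swap k 2 1 x
  have f13 := fun k ↦ F.sdCurv_swap k 1 3 x
  have f32 := fun k ↦ F.sdCurv_swap k 3 2 x
  have fd : ∀ k a, F.sdCurv k a a x = 0 := fun k a ↦ by
    linear_combination (1 / 2) * F.sdCurv_swap k a a x
  have g10 := fun e k ↦ F.dC_sdCurv_swap e k 1 0 x
  have g20 := fun e k ↦ F.dC_sdCurv_swap e k 2 0 x
  have g30 := fun e k ↦ F.dC_sdCurv_swap e k 3 0 x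
  have w10 := fun a ↦ F.conn_swap a 1 0 x
  have w20 := fun a ↦ F.conn_swap a 2 0 x
  have w30 := fun a ↦ F.conn_swap a 3 0 x
  have w21 := fun a ↦ F.conn_swap a 2 1 x
  have w13 := fun a ↦ F.conn_swap a 1 3 x
  have w32 := fun a ↦ F.conn_swap a 3 2 x
  have c0 := fun e ↦ (F.spinConn_eq e x).1
  have c1 := fun e ↦ (F.spinConn_eq e x).2.1
  have c2 := fun e ↦ (F.spinConn_eq e x).2.2.2
  have v0 := fun e ↦ (F.dC_weylComp Λ e x).1
  have v1 := fun e ↦ (F.dC_weylComp Λ e x).2.1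
  have v2 := fun e ↦ (F.dC_weylComp Λ e x).2.2.1
  have v3 := fun e ↦ (F.dC_weylComp Λ e x).2.2.2.1
  have v4 := fun e ↦ (F.dC_weylComp Λ e x).2.2.2.2
  obtain ⟨A0, A1, A2⟩ := F.bianchiSum_eq_zero 0 2 3 x
  obtain ⟨B0, B1, B2⟩ := F.bianchiSum_eq_zero 0 3 1 x
  obtain ⟨C0, C1, C2⟩ := F.bianchiSum_eq_zero 0 1 2 x
  obtain ⟨D0, D1, D2⟩ := F.bianchiSum_eq_zero 1 2 3 x
  simp only [bianchiSum, Fin.sum_univ_four, struct, bracketUp_eq, bracket_eq_conn, eta_zero, eta_one,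
    eta_two, eta_three, f10, f20, f30, f21, f13, f32, fd, g10, g20, g30, h0, h1, h2, d0, d1, d2,
    q1, q2, q3, q4, t1, t2, t3, t4, sdConn, selfDual, Matrix.cons_val_zero, Matrix.cons_val_one,
    Matrix.cons_val, conn_diag, w10, w20, w30, w21, w13, w32]
    at A0 A1 A2 B0 B1 B2 C0 C1 C2 D0 D1 D2
  push_cast at A0 A1 A2 B0 B1 B2 C0 C1 C2 D0 D1 D2
  simp only [covWeyl, v0, v1, v2, v3, v4, c0, c1, c2, weylComp, sdConn, selfDual, Matrix.cons_val_zero,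
    Matrix.cons_val_one, Matrix.cons_val, Nat.reduceAdd, Nat.reduceSub]
  push_cast
  have I5 : I ^ 5 = I := by rw [pow_succ, Complex.I_pow_four, one_mul]
  have I6 : I ^ 6 = -1 := by rw [pow_succ, I5, Complex.I_mul_I]
  refine ⟨⟨?_, ?_, ?_, ?_⟩, ?_, ?_, ?_, ?_⟩
  · linear_combination (norm := skip) (I / 2) * ((A0 - I * B0) - I * (A1 - I * B1))
    ring_nf
    simp only [Complex.I_sq, Complex.I_pow_three, Complex.I_pow_four, I5, I6]
    ring
  · linear_combination (norm := skip) -(I / 2) * (A2 - I * B2)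
    ring_nf
    simp only [Complex.I_sq, Complex.I_pow_three, Complex.I_pow_four, I5, I6]
    ring
  · linear_combination (norm := skip) -(I / 2) * (D2 - C2)
    ring_nf
    simp only [Complex.I_sq, Complex.I_pow_three, Complex.I_pow_four, I5, I6]
    ring
  · linear_combination (norm := skip) -(I / 2) * ((D0 - C0) + I * (D1 - C1))
    ring_nf
    simp only [Complex.I_sq, Complex.I_pow_three, Complex.I_pow_four, I5, I6]
    ring
  · linear_combination (norm := skip) (I / 2) * ((D0 + C0) - I * (D1 + C1))
    ring_nf
    simp only [Complex.I_sq, Complex.I_pow_three, Complex.I_pow_four, I5, I6]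
    ring
  · linear_combination (norm := skip) -(I / 2) * (D2 + C2)
    ring_nf
    simp only [Complex.I_sq, Complex.I_pow_three, Complex.I_pow_four, I5, I6]
    ring
  · linear_combination (norm := skip) -(I / 2) * (A2 + I * B2)
    ring_nf
    simp only [Complex.I_sq, Complex.I_pow_three, Complex.I_pow_four, I5, I6]
    ring
  · linear_combination (norm := skip) -(I / 2) * ((A0 + I * B0) + I * (A1 + I * B1))
    ring_nf
    simp only [Complex.I_sq, Complex.I_pow_three, Complex.I_pow_four, I5, I6]
    ring

end SpinFrame

/-- The component with `n` indices equal to `1` of the symmetric spinor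
`t₄ o_A o_B o_C o_D - t₃ (o_A o_B o_C ι_D + …) + t₂ (o_A o_B ι_C ι_D + …) - t₁ (o_A ι_B ι_C ι_D + …)`,
where `o_A = (α, β)` and `ι_A = (γ, δ)`. -/
def dyadQuartic (α β γ δ t₁ t₂ t₃ t₄ : ℂ) : ℕ → ℂ
  | 0 => t₄ * (α * α * α * α) - t₃ * (4 * (α * α * α * γ)) + t₂ * (6 * (α * α * γ * γ))
      - t₁ * (4 * (α * γ * γ * γ))
  | 1 => t₄ * (α * α * α * β) - t₃ * (3 * (α * α * β * γ) + α * α * α * δ)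
      + t₂ * (3 * (α * β * γ * γ) + 3 * (α * α * γ * δ)) - t₁ * (β * γ * γ * γ + 3 * (α * γ * γ * δ))
  | 2 => t₄ * (α * α * β * β) - t₃ * (2 * (α * β * β * γ) + 2 * (α * α * β * δ))
      + t₂ * (β * β * γ * γ + 4 * (α * β * γ * δ) + α * α * δ * δ)
      - t₁ * (2 * (β * γ * γ * δ) + 2 * (α * γ * δ * δ))
  | 3 => t₄ * (α * β * β * β) - t₃ * (β * β * β * γ + 3 * (α * β * β * δ))
      + t₂ * (3 * (β * β * γ * δ) + 3 * (α * β * δ * δ)) - t₁ * (3 * (β * γ * δ * δ) + α * δ * δ * δ)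
  | 4 => t₄ * (β * β * β * β) - t₃ * (4 * (β * β * β * δ)) + t₂ * (6 * (β * β * δ * δ))
      - t₁ * (4 * (β * δ * δ * δ))
  | _ => 0

/-- The component with `n` indices equal to `1` of the symmetric spinor
`s₂ o_A o_B - s₁ (o_A ι_B + ι_A o_B) + s₀ ι_A ι_B`. -/
def dyadQuadratic (α β γ δ s₀ s₁ s₂ : ℂ) : ℕ → ℂ
  | 0 => s₂ * (α * α) - s₁ * (2 * (α * γ)) + s₀ * (γ * γ)
  | 1 => s₂ * (α * β) - s₁ * (α * δ + β * γ) + s₀ * (γ * δ)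
  | 2 => s₂ * (β * β) - s₁ * (2 * (β * δ)) + s₀ * (δ * δ)
  | _ => 0

namespace SpinFrame

variable {M : Type*} [TopologicalSpace M] [ChartedSpace E4 M] [IsManifold (𝓡 4) ∞ M]
  {g : LorentzMetric M} {F : SpinFrame g} {Λ : ℝ}

variable (F) in
/-- The smooth function `f` has derivative `v` at `x` along the complex vector `∑ₑ cₑ Eₑ`. -/
def HasD (c : Fin 4 → ℂ) (x : M) (f : M → ℂ) (v : ℂ) : Prop :=
  IsSmooth f ∧ ∑ e, c e * F.dC e f x = v

namespace HasD

variable {c : Fin 4 → ℂ} {x : M} {f h : M → ℂ} {u v : ℂ}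

lemma congr (hf : F.HasD c x f v) (e : v = u) : F.HasD c x f u := e ▸ hf

lemma of_isSmooth (hf : IsSmooth f) : F.HasD c x f (∑ e, c e * F.dC e f x) := ⟨hf, rfl⟩

lemma const (k : ℂ) : F.HasD c x (fun _ ↦ k) 0 :=
  ⟨isSmooth_const k, by simp [dC_const]⟩

lemma add (hf : F.HasD c x f u) (hh : F.HasD c x h v) :
    F.HasD c x (fun y ↦ f y + h y) (u + v) := by
  refine ⟨hf.1.fadd hh.1, ?_⟩
  simp_rw [fun e ↦ F.dC_add e (hf.1.mdiff x) (hh.1.mdiff x), mul_add, Finset.sum_add_distrib,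
    hf.2, hh.2]

lemma sub (hf : F.HasD c x f u) (hh : F.HasD c x h v) :
    F.HasD c x (fun y ↦ f y - h y) (u - v) := by
  refine ⟨hf.1.fsub hh.1, ?_⟩
  simp_rw [fun e ↦ F.dC_sub e (hf.1.mdiff x) (hh.1.mdiff x), mul_sub, Finset.sum_sub_distrib,
    hf.2, hh.2]

lemma mul (hf : F.HasD c x f u) (hh : F.HasD c x h v) :
    F.HasD c x (fun y ↦ f y * h y) (f x * v + h x * u) := by
  refine ⟨hf.1.fmul hh.1, ?_⟩
  simp_rw [fun e ↦ F.dC_mul e (hf.1.mdiff x) (hh.1.mdiff x), mul_add, Finset.sum_add_distrib,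
    mul_left_comm (c _), ← Finset.mul_sum, hf.2, hh.2]

lemma unique (hf : F.HasD c x f u) (hf' : F.HasD c x f v) : u = v := hf.2.symm.trans hf'.2

section Dyad

variable {α β γ δ P₂ P₃ P₄ : M → ℂ} {a b k G₀ G₁ G₂ d₂ d₃ d₄ : ℂ}

/-- The covariant derivative of a Weyl spinor of type II, in terms of the derivatives
`∇o_A = a o_A + b ι_A`, `∇ι_A = k o_A - a ι_A` of the dyad. -/
lemma dyadQuartic (hα : F.HasD c x α (a * α x + b * γ x + (G₁ * α x - G₀ * β x)))
    (hβ : F.HasD c x β (a * β x + b * δ x + (G₂ * α x - G₁ * β x)))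
    (hγ : F.HasD c x γ (k * α x - a * γ x + (G₁ * γ x - G₀ * δ x)))
    (hδ : F.HasD c x δ (k * β x - a * δ x + (G₂ * γ x - G₁ * δ x)))
    (h₂ : F.HasD c x P₂ d₂) (h₃ : F.HasD c x P₃ d₃) (h₄ : F.HasD c x P₄ d₄)
    {n : ℕ} (hn : n ≤ 4) :
    F.HasD c x (fun y ↦ SpinGeometry.dyadQuartic (α y) (β y) (γ y) (δ y) 0 (P₂ y) (P₃ y) (P₄ y) n)
      (SpinGeometry.dyadQuartic (α x) (β x) (γ x) (δ x) (-3 * b * P₂ x) (d₂ - 2 * b * P₃ x)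
          (d₃ + 2 * a * P₃ x - b * P₄ x - 3 * k * P₂ x) (d₄ + 4 * a * P₄ x - 4 * k * P₃ x) n
        + (4 - n) * (G₁ * SpinGeometry.dyadQuartic (α x) (β x) (γ x) (δ x) 0 (P₂ x) (P₃ x) (P₄ x) n
          - G₀ * SpinGeometry.dyadQuartic (α x) (β x) (γ x) (δ x) 0 (P₂ x) (P₃ x) (P₄ x) (n + 1))
        + n * (G₂ * SpinGeometry.dyadQuartic (α x) (β x) (γ x) (δ x) 0 (P₂ x) (P₃ x) (P₄ x) (n - 1)
          - G₁ * SpinGeometry.dyadQuartic (α x) (β x) (γ x) (δ x) 0 (P₂ x) (P₃ x) (P₄ x) n)) := by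
  interval_cases n <;> simp only [SpinGeometry.dyadQuartic, Nat.reduceAdd, Nat.reduceSub] <;>
    apply HasD.congr
  any_goals repeat' first
    | exact hα | exact hβ | exact hγ | exact hδ | exact h₂ | exact h₃ | exact h₄
    | exact HasD.const _ | apply HasD.add | apply HasD.sub | apply HasD.mul
  all_goals
    push_cast
    ring

/-- The covariant derivative of a symmetric spinor `φ_{AB}` with `φ_{AB} o^A o^B = 0`, in terms of
the derivatives of the dyad. -/
lemma dyadQuadratic (hα : F.HasD c x α (a * α x + b * γ x + (G₁ * α x - G₀ * β x)))
    (hβ : F.HasD c x β (a * β x + b * δ x + (G₂ * α x - G₁ * β x)))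
    (hγ : F.HasD c x γ (k * α x - a * γ x + (G₁ * γ x - G₀ * δ x)))
    (hδ : F.HasD c x δ (k * β x - a * δ x + (G₂ * γ x - G₁ * δ x)))
    (h₂ : F.HasD c x P₂ d₂) (h₃ : F.HasD c x P₃ d₃) {n : ℕ} (hn : n ≤ 2) :
    F.HasD c x (fun y ↦ SpinGeometry.dyadQuadratic (α y) (β y) (γ y) (δ y) 0 (P₂ y) (P₃ y) n)
      (SpinGeometry.dyadQuadratic (α x) (β x) (γ x) (δ x) (-2 * b * P₂ x) (d₂ - b * P₃ x)
          (d₃ + 2 * a * P₃ x - 2 * k * P₂ x) n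
        + (2 - n) * (G₁ * SpinGeometry.dyadQuadratic (α x) (β x) (γ x) (δ x) 0 (P₂ x) (P₃ x) n
          - G₀ * SpinGeometry.dyadQuadratic (α x) (β x) (γ x) (δ x) 0 (P₂ x) (P₃ x) (n + 1))
        + n * (G₂ * SpinGeometry.dyadQuadratic (α x) (β x) (γ x) (δ x) 0 (P₂ x) (P₃ x) (n - 1)
          - G₁ * SpinGeometry.dyadQuadratic (α x) (β x) (γ x) (δ x) 0 (P₂ x) (P₃ x) n)) := by
  interval_cases n <;> simp only [SpinGeometry.dyadQuadratic, Nat.reduceAdd, Nat.reduceSub] <;>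
    apply HasD.congr
  any_goals repeat' first
    | exact hα | exact hβ | exact hγ | exact hδ | exact h₂ | exact h₃
    | exact HasD.const _ | apply HasD.add | apply HasD.sub | apply HasD.mul
  all_goals
    push_cast
    ring

/-- The covariant derivative of a normalised dyad: `∇o_A = a o_A + b ι_A`, `∇ι_A = k o_A - a ι_A`. -/
lemma exists_dyad_coeff (hα : IsSmooth α) (hβ : IsSmooth β) (hγ : IsSmooth γ) (hδ : IsSmooth δ)
    (hn : ∀ y, α y * δ y - β y * γ y = 1) (c : Fin 4 → ℂ) (x : M) (G₀ G₁ G₂ : ℂ) :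
    ∃ a b k : ℂ, F.HasD c x α (a * α x + b * γ x + (G₁ * α x - G₀ * β x)) ∧
      F.HasD c x β (a * β x + b * δ x + (G₂ * α x - G₁ * β x)) ∧
      F.HasD c x γ (k * α x - a * γ x + (G₁ * γ x - G₀ * δ x)) ∧
      F.HasD c x δ (k * β x - a * δ x + (G₂ * γ x - G₁ * δ x)) := by
  obtain ⟨u₀, hu₀⟩ : ∃ u, F.HasD c x α u := ⟨_, of_isSmooth hα⟩
  obtain ⟨u₁, hu₁⟩ : ∃ u, F.HasD c x β u := ⟨_, of_isSmooth hβ⟩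
  obtain ⟨v₀, hv₀⟩ : ∃ u, F.HasD c x γ u := ⟨_, of_isSmooth hγ⟩
  obtain ⟨v₁, hv₁⟩ : ∃ u, F.HasD c x δ u := ⟨_, of_isSmooth hδ⟩
  have hd := (hu₀.mul hv₁).sub (hu₁.mul hv₀)
  rw [funext hn] at hd
  have hd0 := hd.unique (const 1)
  have hx := hn x
  refine ⟨(u₀ - (G₁ * α x - G₀ * β x)) * δ x - (u₁ - (G₂ * α x - G₁ * β x)) * γ x,
    (u₁ - (G₂ * α x - G₁ * β x)) * α x - (u₀ - (G₁ * α x - G₀ * β x)) * β x,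
    (v₀ - (G₁ * γ x - G₀ * δ x)) * δ x - (v₁ - (G₂ * γ x - G₁ * δ x)) * γ x,
    hu₀.congr ?_, hu₁.congr ?_, hv₀.congr ?_, hv₁.congr ?_⟩
  · linear_combination (-u₀ + (G₁ * α x - G₀ * β x)) * hx
  · linear_combination (-u₁ + (G₂ * α x - G₁ * β x)) * hx
  · linear_combination (-v₀ + (G₁ * γ x - G₀ * δ x)) * hx + γ x * hd0
  · linear_combination (-v₁ + (G₂ * γ x - G₁ * δ x)) * hx + δ x * hd0

end Dyad
end HasD
end SpinFrame

lemma lower_zero (ψ : Fin 2 → ℂ) : lower ψ 0 = - ψ 1 := by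
  simp [lower, eps_zero_zero, eps_one_zero]

lemma lower_one (ψ : Fin 2 → ℂ) : lower ψ 1 = ψ 0 := by
  simp [lower, eps_zero_one, eps_one_one]

/-- A Weyl spinor with components `w n` whose contractions with `o o o o` and `o o o ι` vanish is
given by its remaining dyad components. -/
lemma eq_dyadQuartic {α β γ δ : ℂ} (hW : α * δ - β * γ = 1) {w : ℕ → ℂ}
    (h0 : w 0 * β ^ 3 - 3 * w 1 * β ^ 2 * α + 3 * w 2 * β * α ^ 2 - w 3 * α ^ 3 = 0)
    (h1 : w 1 * β ^ 3 - 3 * w 2 * β ^ 2 * α + 3 * w 3 * β * α ^ 2 - w 4 * α ^ 3 = 0)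
    {P₂ P₃ P₄ : ℂ}
    (h₂ : P₂ = w 0 * β ^ 2 * δ ^ 2 - 2 * w 1 * (β ^ 2 * γ * δ + α * β * δ ^ 2)
      + w 2 * (β ^ 2 * γ ^ 2 + 4 * α * β * γ * δ + α ^ 2 * δ ^ 2)
      - 2 * w 3 * (α ^ 2 * γ * δ + α * β * γ ^ 2) + w 4 * α ^ 2 * γ ^ 2)
    (h₃ : P₃ = w 0 * β * δ ^ 3 - w 1 * (α * δ ^ 3 + 3 * β * γ * δ ^ 2)
      + 3 * w 2 * (β * γ ^ 2 * δ + α * γ * δ ^ 2) - w 3 * (β * γ ^ 3 + 3 * α * γ ^ 2 * δ)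
      + w 4 * α * γ ^ 3)
    (h₄ : P₄ = w 0 * δ ^ 4 - 4 * w 1 * γ * δ ^ 3 + 6 * w 2 * γ ^ 2 * δ ^ 2 - 4 * w 3 * γ ^ 3 * δ
      + w 4 * γ ^ 4)
    {n : ℕ} (hn : n ≤ 4) : w n = dyadQuartic α β γ δ 0 P₂ P₃ P₄ n := by
  set W := α * δ - β * γ with hWdef
  have hW4 : ∀ v : ℂ, v = v * W ^ 4 := fun v ↦ by rw [hW]; ring
  rw [hW4 (w n), hWdef]
  have c0 : β * (w 0 * β ^ 3 - 3 * w 1 * β ^ 2 * α + 3 * w 2 * β * α ^ 2 - w 3 * α ^ 3)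
    - α * (w 1 * β ^ 3 - 3 * w 2 * β ^ 2 * α + 3 * w 3 * β * α ^ 2 - w 4 * α ^ 3) = 0 := by
      rw [h0, h1]; ring
  have c1 : δ * (w 0 * β ^ 3 - 3 * w 1 * β ^ 2 * α + 3 * w 2 * β * α ^ 2 - w 3 * α ^ 3)
    - γ * (w 1 * β ^ 3 - 3 * w 2 * β ^ 2 * α + 3 * w 3 * β * α ^ 2 - w 4 * α ^ 3) = 0 := by
      rw [h0, h1]; ring
  subst h₂ h₃ h₄
  interval_cases n <;> simp only [dyadQuartic]
  · linear_combination γ ^ 4 * c0 - 4 * α * γ ^ 3 * c1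
  · linear_combination γ ^ 3 * δ * c0 - (β * γ ^ 3 + 3 * α * γ ^ 2 * δ) * c1
  · linear_combination γ ^ 2 * δ ^ 2 * c0 - (2 * β * γ ^ 2 * δ + 2 * α * γ * δ ^ 2) * c1
  · linear_combination γ * δ ^ 3 * c0 - (3 * β * γ * δ ^ 2 + α * δ ^ 3) * c1
  · linear_combination δ ^ 4 * c0 - 4 * β * δ ^ 3 * c1

/-- The dyad form of the Bianchi identities for a Weyl spinor of type II. -/
lemma dyadQuartic_divergence {α β γ δ : ℂ} (hW : α * δ - β * γ = 1)
    {t₁ t₂ t₃ t₄ s₁ s₂ s₃ s₄ : ℂ}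
    (h : ∀ n < 4, dyadQuartic α β γ δ s₁ s₂ s₃ s₄ n - dyadQuartic α β γ δ t₁ t₂ t₃ t₄ (n + 1) = 0) :
    β * t₁ - α * s₁ = 0 ∧ β * t₂ - α * s₂ - (δ * t₁ - γ * s₁) = 0 ∧
      β * t₃ - α * s₃ - (δ * t₂ - γ * s₂) = 0 := by
  have h0 := h 0 (by norm_num)
  have h1 := h 1 (by norm_num)
  have h2 := h 2 (by norm_num)
  have h3 := h 3 (by norm_num)
  simp only [dyadQuartic, Nat.reduceAdd] at h0 h1 h2 h3
  have hW3 : ∀ v : ℂ, (α * δ - β * γ) ^ 3 * v = 0 → v = 0 := fun v hv ↦ by simpa [hW] using hv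
  refine ⟨hW3 _ ?_, hW3 _ ?_, hW3 _ ?_⟩
  · linear_combination -(β ^ 3 * h0 - 3 * α * β ^ 2 * h1 + 3 * α ^ 2 * β * h2 - α ^ 3 * h3)
  · linear_combination -(β ^ 2 * δ * h0 - (β ^ 2 * γ + 2 * α * β * δ) * h1
      + (α ^ 2 * δ + 2 * α * β * γ) * h2 - α ^ 2 * γ * h3)
  · linear_combination -(β * δ ^ 2 * h0 - (α * δ ^ 2 + 2 * β * γ * δ) * h1
      + (β * γ ^ 2 + 2 * α * γ * δ) * h2 - α * γ ^ 2 * h3)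

/-- The dyad form of the divergence of a symmetric spinor `φ_{AB}`. -/
lemma dyadQuadratic_divergence {α β γ δ : ℂ}
    {t₀ t₁ t₂ s₀ s₁ s₂ : ℂ} (h₁ : β * t₁ - α * s₁ - (δ * t₀ - γ * s₀) = 0)
    (h₂ : β * t₂ - α * s₂ - (δ * t₁ - γ * s₁) = 0) :
    dyadQuadratic α β γ δ s₀ s₁ s₂ 0 - dyadQuadratic α β γ δ t₀ t₁ t₂ 1 = 0 ∧
      dyadQuadratic α β γ δ s₀ s₁ s₂ 1 - dyadQuadratic α β γ δ t₀ t₁ t₂ 2 = 0 := by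
  simp only [dyadQuadratic]
  constructor
  · linear_combination γ * h₁ - α * h₂
  · linear_combination δ * h₁ - β * h₂

namespace SpinFrame

variable {M : Type*} [TopologicalSpace M] [ChartedSpace E4 M] [IsManifold (𝓡 4) ∞ M]
  {g : LorentzMetric M} {F : SpinFrame g} {Λ : ℝ}

/-- The Bianchi identities `∇^{AA'} Ψ_{ABCD} = 0`. -/
lemma EinsteinWith.bianchi_solder (hE : F.EinsteinWith Λ) (x : M) (E' : Fin 2) (n : ℕ) (hn : n < 4) :
    ∑ e, solder e 1 E' * F.covWeyl Λ e n x - ∑ e, solder e 0 E' * F.covWeyl Λ e (n + 1) x = 0 := by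
  obtain ⟨⟨a0, a1, a2, a3⟩, b0, b1, b2, b3⟩ := hE.bianchi x
  fin_cases E' <;> interval_cases n <;>
    simp only [Fin.sum_univ_four, solder, pauli, Matrix.of_apply, Matrix.cons_val_zero,
      Matrix.cons_val_one, Matrix.cons_val, Matrix.cons_val', Fin.zero_eta, Fin.mk_one, Fin.isValue,
      Nat.reduceAdd]
  · linear_combination ((Real.sqrt 2 : ℝ) : ℂ)⁻¹ * b0
  · linear_combination ((Real.sqrt 2 : ℝ) : ℂ)⁻¹ * b1
  · linear_combination ((Real.sqrt 2 : ℝ) : ℂ)⁻¹ * b2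
  · linear_combination ((Real.sqrt 2 : ℝ) : ℂ)⁻¹ * b3
  · linear_combination ((Real.sqrt 2 : ℝ) : ℂ)⁻¹ * a0
  · linear_combination ((Real.sqrt 2 : ℝ) : ℂ)⁻¹ * a1
  · linear_combination ((Real.sqrt 2 : ℝ) : ℂ)⁻¹ * a2
  · linear_combination ((Real.sqrt 2 : ℝ) : ℂ)⁻¹ * a3

section Dyad

variable {o ι : M → Fin 2 → ℂ}

variable (F) in
/-- `Ψ₄ = Ψ_{ABCD} ι^A ι^B ι^C ι^D`. -/
def Psi4 (ι : M → Fin 2 → ℂ) (x : M) : ℂ :=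
  ∑ A, ∑ B, ∑ C, ∑ D, F.weyl A B C D x * ι x A * ι x B * ι x C * ι x D

lemma isSmooth_lower (ho : ContMDiff (𝓡 4) 𝓘(ℝ, Fin 2 → ℂ) ∞ o) (A : Fin 2) :
    IsSmooth (fun x ↦ lower (o x) A) := by
  have h := contMDiff_pi_space.1 ho
  exact isSmooth_sum fun B ↦ IsSmooth.fmul (h B) (isSmooth_const _)

lemma EinsteinWith.isSmooth_weyl (hE : F.EinsteinWith Λ) (A B C D : Fin 2) :
    IsSmooth (F.weyl A B C D) := by
  rw [funext (hE.weyl_eq A B C D)]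
  exact F.isSmooth_weylComp Λ _

lemma _root_.SpinGeometry.IsSpinDyad.lower_det (h : IsSpinDyad o ι) (x : M) :
    lower (o x) 0 * lower (ι x) 1 - lower (o x) 1 * lower (ι x) 0 = 1 := by
  have := h.2.2 x
  simp only [Fin.sum_univ_two, lower_zero, lower_one] at *
  linear_combination this

lemma EinsteinWith.weylComp_eq_dyadQuartic (hE : F.EinsteinWith Λ) (hd : IsSpinDyad o ι)
    (hII : F.IsPetrovTypeII o ι) (x : M) {n : ℕ} (hn : n ≤ 4) :
    F.weylComp Λ n x = dyadQuartic (lower (o x) 0) (lower (o x) 1) (lower (ι x) 0) (lower (ι x) 1)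
      0 (F.Psi2 o ι x) (F.Psi3 o ι x) (F.Psi4 ι x) n := by
  have h0 := hII.1 x 0
  have h1 := hII.1 x 1
  refine eq_dyadQuartic (w := fun n ↦ F.weylComp Λ n x) (hd.lower_det x) ?_ ?_ ?_ ?_ ?_ hn
  all_goals
    simp only [Psi2, Psi3, Psi4, hE.weyl_eq, Fin.sum_univ_two, lower_zero, lower_one, Fin.val_zero,
      Fin.val_one, Nat.reduceAdd] at *
  · linear_combination h0
  · linear_combination h1
  · ring
  · ring
  · ring

lemma EinsteinWith.isSmooth_Psi (hE : F.EinsteinWith Λ) (hd : IsSpinDyad o ι) :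
    IsSmooth (F.Psi3 o ι) ∧ IsSmooth (F.Psi4 ι) := by
  have ho : ∀ A, IsSmooth (fun x ↦ o x A) := contMDiff_pi_space.1 hd.1
  have hi : ∀ A, IsSmooth (fun x ↦ ι x A) := contMDiff_pi_space.1 hd.2.1
  have hw := hE.isSmooth_weyl
  refine ⟨?_, ?_⟩ <;>
    refine isSmooth_sum fun A ↦ isSmooth_sum fun B ↦ isSmooth_sum fun C ↦ isSmooth_sum fun D ↦ ?_
  · exact ((((hw A B C D).fmul (ho A)).fmul (hi B)).fmul (hi C)).fmul (hi D)
  · exact ((((hw A B C D).fmul (hi A)).fmul (hi B)).fmul (hi C)).fmul (hi D)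

variable {p : M → ℂ}

lemma EinsteinWith.spinLowering_eq (hE : F.EinsteinWith Λ) (hd : IsSpinDyad o ι)
    (hII : F.IsPetrovTypeII o ι) (hp3 : ∀ x, p x ^ 3 = F.Psi2 o ι x) (x : M) (A B : Fin 2) :
    F.spinLowering (F.projectedKillingSpinor o ι p) x A B =
      -2 * F.Psi2 o ι x * F.projectedKillingSpinor o ι p x A B := by
  have hW := hd.lower_det x
  have hp0 : p x ≠ 0 := fun h ↦ hII.2 x (by rw [← hp3, h]; ring)
  have hk : (p x)⁻¹ * F.Psi3 o ι x
      = 3 * ((1 / 3) * ((p x) ^ 4)⁻¹ * F.Psi3 o ι x) * F.Psi2 o ι x := by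
    rw [← hp3]
    field_simp
  have w := fun n hn ↦ hE.weylComp_eq_dyadQuartic hd hII x (n := n) hn
  have w0 := w 0 (by norm_num)
  have w1 := w 1 (by norm_num)
  have w2 := w 2 (by norm_num)
  have w3 := w 3 (by norm_num)
  have w4 := w 4 (by norm_num)
  simp only [spinLowering, raise₂, projectedKillingSpinor, Fin.sum_univ_two, eps_zero_zero,
    eps_zero_one, eps_one_zero, eps_one_one, hE.weyl_eq]
  generalize (1 / 3 : ℂ) * ((p x) ^ 4)⁻¹ * F.Psi3 o ι x = k₂ at *
  generalize (p x)⁻¹ = k₁ at *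
  fin_cases A <;> fin_cases B <;>
    simp only [Fin.zero_eta, Fin.mk_one, Fin.isValue, Fin.val_zero, Fin.val_one, Nat.reduceAdd, w0,
      w1, w2, w3, w4, dyadQuartic]
  all_goals
    generalize lower (o x) 0 = α at *
    generalize lower (o x) 1 = β at *
    generalize lower (ι x) 0 = γ at *
    generalize lower (ι x) 1 = δ at *
    generalize F.Psi2 o ι x = P₂ at *
    generalize F.Psi3 o ι x = P₃ at *
  · linear_combination (α * α) * hk + ((k₁ * P₃ - k₂ * P₂) * (α * α) - k₁ * P₂ * (2 * (α * γ)))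
      * (α * δ - β * γ + 1) * hW
  · linear_combination (α * β) * hk + ((k₁ * P₃ - k₂ * P₂) * (α * β)
      - k₁ * P₂ * (α * δ + β * γ)) * (α * δ - β * γ + 1) * hW
  · linear_combination (α * β) * hk + ((k₁ * P₃ - k₂ * P₂) * (α * β)
      - k₁ * P₂ * (α * δ + β * γ)) * (α * δ - β * γ + 1) * hW
  · linear_combination (β * β) * hk + ((k₁ * P₃ - k₂ * P₂) * (β * β) - k₁ * P₂ * (2 * (β * δ)))
      * (α * δ - β * γ + 1) * hW

lemma EinsteinWith.spinLowering_eq_dyadQuadratic (hE : F.EinsteinWith Λ) (hd : IsSpinDyad o ι)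
    (hII : F.IsPetrovTypeII o ι) (hp3 : ∀ x, p x ^ 3 = F.Psi2 o ι x) (x : M) (A B : Fin 2) :
    F.spinLowering (F.projectedKillingSpinor o ι p) x A B =
      dyadQuadratic (lower (o x) 0) (lower (o x) 1) (lower (ι x) 0) (lower (ι x) 1)
        0 (p x * p x) ((2 / 3) * ((p x)⁻¹ * F.Psi3 o ι x)) ((A : ℕ) + B) := by
  have hp0 : p x ≠ 0 := fun h ↦ hII.2 x (by rw [← hp3, h]; ring)
  have h1 : F.Psi2 o ι x * (p x)⁻¹ = p x * p x := by rw [← hp3]; field_simp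
  have h2 : F.Psi2 o ι x * ((p x) ^ 4)⁻¹ = (p x)⁻¹ := by rw [← hp3]; field_simp
  rw [hE.spinLowering_eq hd hII hp3, projectedKillingSpinor]
  fin_cases A <;> fin_cases B <;>
    simp only [Fin.zero_eta, Fin.mk_one, Fin.isValue, dyadQuadratic]
  · linear_combination (-2 * lower (o x) 0 * lower (ι x) 0) * h1
      + (2 / 3) * F.Psi3 o ι x * lower (o x) 0 * lower (o x) 0 * h2
  · linear_combination (-(lower (o x) 0 * lower (ι x) 1 + lower (o x) 1 * lower (ι x) 0)) * h1
      + (2 / 3) * F.Psi3 o ι x * lower (o x) 0 * lower (o x) 1 * h2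
  · linear_combination (-(lower (o x) 0 * lower (ι x) 1 + lower (o x) 1 * lower (ι x) 0)) * h1
      + (2 / 3) * F.Psi3 o ι x * lower (o x) 0 * lower (o x) 1 * h2
  · linear_combination (-2 * lower (o x) 1 * lower (ι x) 1) * h1
      + (2 / 3) * F.Psi3 o ι x * lower (o x) 1 * lower (o x) 1 * h2

end Dyad

end SpinFrame

namespace SpinFrame

variable {M : Type*} [TopologicalSpace M] [ChartedSpace E4 M] [IsManifold (𝓡 4) ∞ M]
  {g : LorentzMetric M} {F : SpinFrame g} {Λ : ℝ}

lemma spinConnUp_zero (a : Fin 4) (B : Fin 2) (x : M) :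
    F.spinConnUp a B 0 x = F.spinConn a B 1 x := by
  simp [spinConnUp, eps_zero_zero, eps_zero_one]

lemma spinConnUp_one (a : Fin 4) (B : Fin 2) (x : M) :
    F.spinConnUp a B 1 x = - F.spinConn a B 0 x := by
  simp [spinConnUp, eps_one_zero, eps_one_one]

/-- The divergence of a symmetric spinor in terms of the components of `∇φ`. -/
lemma divergence_eq_zero {φ : M → Fin 2 → Fin 2 → ℂ} {x : M} {B : Fin 2}
    (h : ∀ E', ∑ e, solder e 1 E' * F.nabla₂ φ e 0 B x
      - ∑ e, solder e 0 E' * F.nabla₂ φ e 1 B x = 0) (A' : Fin 2) :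
    F.divergence φ A' B x = 0 := by
  have h0 := h 0
  have h1 := h 1
  simp only [divergence, spinNabla₂, Fin.sum_univ_two]
  fin_cases A' <;>
    simp only [Fin.zero_eta, Fin.mk_one, Fin.isValue, eps_zero_zero, eps_zero_one, eps_one_zero,
      eps_one_one]
  · linear_combination h1
  · linear_combination -h0

section Components

variable {c : Fin 4 → ℂ} {x : M} {α β γ δ P₂ P₃ P₄ : M → ℂ} {a b k d₂ d₃ d₄ : ℂ}

lemma sum_mul_covWeyl (n : ℕ) : ∑ e, c e * F.covWeyl Λ e n x =
    ∑ e, c e * F.dC e (F.weylComp Λ n) x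
      - (4 - n) * ((∑ e, c e * F.spinConn e 0 1 x) * F.weylComp Λ n x
        - (∑ e, c e * F.spinConn e 0 0 x) * F.weylComp Λ (n + 1) x)
      - n * ((∑ e, c e * F.spinConn e 1 1 x) * F.weylComp Λ (n - 1) x
        - (∑ e, c e * F.spinConn e 0 1 x) * F.weylComp Λ n x) := by
  simp only [covWeyl, Fin.sum_univ_four]
  ring

lemma HasD.sum_covWeyl
    (hα : F.HasD c x α (a * α x + b * γ x
      + ((∑ e, c e * F.spinConn e 0 1 x) * α x - (∑ e, c e * F.spinConn e 0 0 x) * β x)))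
    (hβ : F.HasD c x β (a * β x + b * δ x
      + ((∑ e, c e * F.spinConn e 1 1 x) * α x - (∑ e, c e * F.spinConn e 0 1 x) * β x)))
    (hγ : F.HasD c x γ (k * α x - a * γ x
      + ((∑ e, c e * F.spinConn e 0 1 x) * γ x - (∑ e, c e * F.spinConn e 0 0 x) * δ x)))
    (hδ : F.HasD c x δ (k * β x - a * δ x
      + ((∑ e, c e * F.spinConn e 1 1 x) * γ x - (∑ e, c e * F.spinConn e 0 1 x) * δ x)))
    (h₂ : F.HasD c x P₂ d₂) (h₃ : F.HasD c x P₃ d₃) (h₄ : F.HasD c x P₄ d₄)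
    (hw : ∀ y, ∀ n ≤ 4, F.weylComp Λ n y
      = SpinGeometry.dyadQuartic (α y) (β y) (γ y) (δ y) 0 (P₂ y) (P₃ y) (P₄ y) n)
    {n : ℕ} (hn : n ≤ 4) :
    ∑ e, c e * F.covWeyl Λ e n x =
      SpinGeometry.dyadQuartic (α x) (β x) (γ x) (δ x) (-3 * b * P₂ x) (d₂ - 2 * b * P₃ x)
        (d₃ + 2 * a * P₃ x - b * P₄ x - 3 * k * P₂ x) (d₄ + 4 * a * P₄ x - 4 * k * P₃ x) n := by
  have h := (HasD.dyadQuartic hα hβ hγ hδ h₂ h₃ h₄ hn).2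
  rw [← funext fun y ↦ hw y n hn, ← hw x n hn, ← hw x (n - 1) (by omega)] at h
  have hs : (4 - n : ℂ) * SpinGeometry.dyadQuartic (α x) (β x) (γ x) (δ x) 0 (P₂ x) (P₃ x) (P₄ x)
      (n + 1) = (4 - n) * F.weylComp Λ (n + 1) x := by
    rcases hn.lt_or_eq with h4 | rfl
    · rw [hw x (n + 1) h4]
    · norm_num
  rw [sum_mul_covWeyl]
  linear_combination h - (∑ e, c e * F.spinConn e 0 0 x) * hs

lemma sum_mul_nabla₂ {φ : M → Fin 2 → Fin 2 → ℂ} {f : ℕ → M → ℂ}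
    (hφ : ∀ y (A B : Fin 2), φ y A B = f ((A : ℕ) + B) y) (A B : Fin 2) {n : ℕ}
    (hn : (A : ℕ) + B = n) :
    ∑ e, c e * F.nabla₂ φ e A B x =
    ∑ e, c e * F.dC e (f n) x
      - (2 - n) * ((∑ e, c e * F.spinConn e 0 1 x) * f n x
        - (∑ e, c e * F.spinConn e 0 0 x) * f (n + 1) x)
      - n * ((∑ e, c e * F.spinConn e 1 1 x) * f (n - 1) x
        - (∑ e, c e * F.spinConn e 0 1 x) * f n x) := by
  subst hn
  have hs : ∀ e, F.spinConn e 1 0 x = F.spinConn e 0 1 x := fun e ↦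
    (F.spinConn_eq e x).2.2.1.trans (F.spinConn_eq e x).2.1.symm
  fin_cases A <;> fin_cases B <;>
    simp [nabla₂, hφ, Fin.sum_univ_four, spinConnUp_zero, spinConnUp_one, hs] <;> ring

lemma HasD.sum_nabla₂ {φ : M → Fin 2 → Fin 2 → ℂ}
    (hα : F.HasD c x α (a * α x + b * γ x
      + ((∑ e, c e * F.spinConn e 0 1 x) * α x - (∑ e, c e * F.spinConn e 0 0 x) * β x)))
    (hβ : F.HasD c x β (a * β x + b * δ x
      + ((∑ e, c e * F.spinConn e 1 1 x) * α x - (∑ e, c e * F.spinConn e 0 1 x) * β x)))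
    (hγ : F.HasD c x γ (k * α x - a * γ x
      + ((∑ e, c e * F.spinConn e 0 1 x) * γ x - (∑ e, c e * F.spinConn e 0 0 x) * δ x)))
    (hδ : F.HasD c x δ (k * β x - a * δ x
      + ((∑ e, c e * F.spinConn e 1 1 x) * γ x - (∑ e, c e * F.spinConn e 0 1 x) * δ x)))
    (h₂ : F.HasD c x P₂ d₂) (h₃ : F.HasD c x P₃ d₃)
    (hφ : ∀ y (A B : Fin 2), φ y A B
      = SpinGeometry.dyadQuadratic (α y) (β y) (γ y) (δ y) 0 (P₂ y) (P₃ y) ((A : ℕ) + B))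
    (A B : Fin 2) {n : ℕ} (hn : (A : ℕ) + B = n) :
    ∑ e, c e * F.nabla₂ φ e A B x =
      SpinGeometry.dyadQuadratic (α x) (β x) (γ x) (δ x) (-2 * b * P₂ x) (d₂ - b * P₃ x)
          (d₃ + 2 * a * P₃ x - 2 * k * P₂ x) n := by
  have h := (HasD.dyadQuadratic hα hβ hγ hδ h₂ h₃ (n := n) (by omega)).2
  rw [sum_mul_nabla₂ (f := fun n y ↦
    SpinGeometry.dyadQuadratic (α y) (β y) (γ y) (δ y) 0 (P₂ y) (P₃ y) n) hφ A B hn]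
  linear_combination h

/-- The derivatives of a Weyl spinor of type II with `Ψ₂ = p³` and of the spinor obtained from it by
spin lowering, along a complex direction. -/
lemma exists_dyad_derivative {p q : M → ℂ} {φ : M → Fin 2 → Fin 2 → ℂ}
    (hα : IsSmooth α) (hβ : IsSmooth β) (hγ : IsSmooth γ)
    (hδ : IsSmooth δ) (hn : ∀ y, α y * δ y - β y * γ y = 1) (hp : IsSmooth p) (hq : IsSmooth q)
    (hP₃ : IsSmooth P₃) (hP₄ : IsSmooth P₄) (hpq : ∀ y, p y * q y = (2 / 3) * P₃ y)
    (hw : ∀ y, ∀ n ≤ 4, F.weylComp Λ n y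
      = dyadQuartic (α y) (β y) (γ y) (δ y) 0 (p y ^ 3) (P₃ y) (P₄ y) n)
    (hφ : ∀ y (A B : Fin 2), φ y A B
      = dyadQuadratic (α y) (β y) (γ y) (δ y) 0 (p y * p y) (q y) ((A : ℕ) + B))
    (c : Fin 4 → ℂ) (x : M) :
    ∃ a b k dp dq d₃ d₄ : ℂ, p x * dq + q x * dp = (2 / 3) * d₃ ∧
      (∀ n ≤ 4, ∑ e, c e * F.covWeyl Λ e n x =
        dyadQuartic (α x) (β x) (γ x) (δ x) (-3 * b * p x ^ 3) (3 * p x ^ 2 * dp - 2 * b * P₃ x)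
          (d₃ + 2 * a * P₃ x - b * P₄ x - 3 * k * p x ^ 3) (d₄ + 4 * a * P₄ x - 4 * k * P₃ x) n) ∧
      ∀ (A B : Fin 2) (n : ℕ), (A : ℕ) + B = n → ∑ e, c e * F.nabla₂ φ e A B x =
        dyadQuadratic (α x) (β x) (γ x) (δ x) (-2 * b * (p x * p x)) (2 * p x * dp - b * q x)
          (dq + 2 * a * q x - 2 * k * (p x * p x)) n := by
  obtain ⟨a, b, k, Dα, Dβ, Dγ, Dδ⟩ := HasD.exists_dyad_coeff (F := F) hα hβ hγ hδ hn c x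
    (∑ e, c e * F.spinConn e 0 0 x) (∑ e, c e * F.spinConn e 0 1 x) (∑ e, c e * F.spinConn e 1 1 x)
  have hasD : ∀ {f : M → ℂ}, IsSmooth f → ∃ d, F.HasD c x f d :=
    fun hf ↦ ⟨_, HasD.of_isSmooth hf⟩
  obtain ⟨dp, Dp⟩ := hasD hp
  obtain ⟨dq, Dq⟩ := hasD hq
  obtain ⟨d₃, D₃⟩ := hasD hP₃
  obtain ⟨d₄, D₄⟩ := hasD hP₄
  have D₂ := ((Dp.mul Dp).mul Dp).congr (show _ = 3 * p x ^ 2 * dp by ring)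
  rw [show (fun y ↦ p y * p y * p y) = fun y ↦ p y ^ 3 from funext fun y ↦ by ring] at D₂
  have Ds := (Dp.mul Dp).congr (show _ = 2 * p x * dp by ring)
  have Dpq := Dp.mul Dq
  rw [funext hpq] at Dpq
  exact ⟨a, b, k, dp, dq, d₃, d₄,
    (Dpq.unique ((HasD.const (2 / 3)).mul D₃)).trans (by ring),
    fun n hn ↦ HasD.sum_covWeyl Dα Dβ Dγ Dδ D₂ D₃ D₄ hw hn,
    fun A B n hn ↦ HasD.sum_nabla₂ Dα Dβ Dγ Dδ Ds Dq hφ A B hn⟩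

end Components

section Dyad

variable {o ι : M → Fin 2 → ℂ} {p : M → ℂ}

lemma IsSmooth.finv {f : M → ℂ} (hf : IsSmooth f) (h0 : ∀ x, f x ≠ 0) :
    IsSmooth (fun x ↦ (f x)⁻¹) := fun x ↦
  ((contDiffAt_inv ℝ (h0 x)).contMDiffAt).comp x (hf x)

lemma EinsteinWith.divergence_spinLowering (hE : F.EinsteinWith Λ) (hd : IsSpinDyad o ι)
    (hII : F.IsPetrovTypeII o ι) (hp : IsSmooth p) (hp3 : ∀ x, p x ^ 3 = F.Psi2 o ι x)
    (x : M) (A' B : Fin 2) :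
    F.divergence (F.spinLowering (F.projectedKillingSpinor o ι p)) A' B x = 0 := by
  have hp0 : ∀ y, p y ≠ 0 := fun y h ↦ hII.2 y (by rw [← hp3, h]; ring)
  refine divergence_eq_zero (fun E' ↦ ?_) A'
  obtain ⟨hP₃, hP₄⟩ := hE.isSmooth_Psi hd
  have hq : IsSmooth (fun y ↦ (2 / 3) * ((p y)⁻¹ * F.Psi3 o ι y)) :=
    (isSmooth_const _).fmul ((IsSmooth.finv hp hp0).fmul hP₃)
  have key := fun E ↦ exists_dyad_derivative (F := F) (isSmooth_lower hd.1 0)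
    (isSmooth_lower hd.1 1) (isSmooth_lower hd.2.1 0) (isSmooth_lower hd.2.1 1) hd.lower_det
    hp hq hP₃ hP₄ (fun y ↦ by rw [mul_left_comm, mul_inv_cancel_left₀ (hp0 y)])
    (fun y n hn ↦ hp3 y ▸ hE.weylComp_eq_dyadQuartic hd hII y hn)
    (hE.spinLowering_eq_dyadQuadratic hd hII hp3) (fun e ↦ solder e E E') x
  obtain ⟨a₀, b₀, k₀, u₀, v₀, w₀, z₀, r₀, hw₀, hφ₀⟩ := key 0
  obtain ⟨a₁, b₁, k₁, u₁, v₁, w₁, z₁, r₁, hw₁, hφ₁⟩ := key 1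
  obtain ⟨e₁, e₂, e₃⟩ := dyadQuartic_divergence (hd.lower_det x) fun n hn ↦ by
    rw [← hw₁ n hn.le, ← hw₀ (n + 1) hn]
    exact hE.bianchi_solder x E' n hn
  have hpx := hp0 x
  obtain ⟨q, hqx⟩ : ∃ q, q = (2 / 3) * ((p x)⁻¹ * F.Psi3 o ι x) := ⟨_, rfl⟩
  have hP3 : F.Psi3 o ι x = (3 / 2) * (p x * q) := by rw [hqx]; field_simp
  rw [← hqx] at r₀ r₁
  simp only [← hqx] at hφ₀ hφ₁
  rw [hP3] at e₂ e₃
  have hb : lower (o x) 1 * b₀ - lower (o x) 0 * b₁ = 0 := by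
    have : p x ^ 3 * (lower (o x) 1 * b₀ - lower (o x) 0 * b₁) = 0 := by
      linear_combination (-1 / 3 : ℂ) * e₁
    exact (mul_eq_zero.1 this).resolve_left (pow_ne_zero 3 hpx)
  have f₁ : lower (o x) 1 * (2 * p x * u₀ - b₀ * q) - lower (o x) 0 * (2 * p x * u₁ - b₁ * q)
      - (lower (ι x) 1 * (-2 * b₀ * (p x * p x)) - lower (ι x) 0 * (-2 * b₁ * (p x * p x))) = 0 := by
    refine (mul_eq_zero.1 (?_ : p x * _ = 0)).resolve_left hpx
    linear_combination (2 / 3 : ℂ) * e₂ + p x * q * hb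
  have f₂ : lower (o x) 1 * (v₀ + 2 * a₀ * q - 2 * k₀ * (p x * p x))
      - lower (o x) 0 * (v₁ + 2 * a₁ * q - 2 * k₁ * (p x * p x))
      - (lower (ι x) 1 * (2 * p x * u₀ - b₀ * q) - lower (ι x) 0 * (2 * p x * u₁ - b₁ * q)) = 0 := by
    have g₁ : lower (o x) 1 * u₀ - lower (o x) 0 * u₁
        + (lower (ι x) 1 * b₀ - lower (ι x) 0 * b₁) * p x = 0 := by
      refine (mul_eq_zero.1 (?_ : p x * _ = 0)).resolve_left hpx
      linear_combination (1 / 2 : ℂ) * f₁ + (1 / 2 : ℂ) * q * hb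
    refine (mul_eq_zero.1 (?_ : p x * _ = 0)).resolve_left hpx
    linear_combination (2 / 3 : ℂ) * e₃ + (2 / 3 : ℂ) * F.Psi4 ι x * hb
      + lower (o x) 1 * r₀ - lower (o x) 0 * r₁ - q * g₁
  obtain ⟨m₀, m₁⟩ := dyadQuadratic_divergence f₁ f₂
  fin_cases B
  · exact (congrArg₂ (· - ·) (hφ₁ 0 0 0 rfl) (hφ₀ 1 0 1 rfl)).trans m₀
  · exact (congrArg₂ (· - ·) (hφ₁ 0 1 1 rfl) (hφ₀ 1 1 2 rfl)).trans m₁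

lemma isSmooth_dyadQuadratic {α β γ δ s₁ s₂ : M → ℂ} (hα : IsSmooth α) (hβ : IsSmooth β)
    (hγ : IsSmooth γ) (hδ : IsSmooth δ) (h₁ : IsSmooth s₁) (h₂ : IsSmooth s₂) (n : ℕ) :
    IsSmooth (fun y ↦ dyadQuadratic (α y) (β y) (γ y) (δ y) 0 (s₁ y) (s₂ y) n) := by
  have h0 : IsSmooth (fun _ : M ↦ (0 : ℂ)) := isSmooth_const 0
  match n with
  | 0 =>
    exact ((h₂.fmul (hα.fmul hα)).fsub (h₁.fmul ((isSmooth_const 2).fmul (hα.fmul hγ)))).fadd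
      (h0.fmul (hγ.fmul hγ))
  | 1 =>
    exact ((h₂.fmul (hα.fmul hβ)).fsub (h₁.fmul ((hα.fmul hδ).fadd (hβ.fmul hγ)))).fadd
      (h0.fmul (hγ.fmul hδ))
  | 2 =>
    exact ((h₂.fmul (hβ.fmul hβ)).fsub (h₁.fmul ((isSmooth_const 2).fmul (hβ.fmul hδ)))).fadd
      (h0.fmul (hδ.fmul hδ))
  | _ + 3 => exact h0

lemma EinsteinWith.isMaxwellField_spinLowering (hE : F.EinsteinWith Λ) (hd : IsSpinDyad o ι)
    (hII : F.IsPetrovTypeII o ι) (hp : IsSmooth p) (hp3 : ∀ x, p x ^ 3 = F.Psi2 o ι x) :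
    F.IsMaxwellField (F.spinLowering (F.projectedKillingSpinor o ι p)) := by
  have hφ := hE.spinLowering_eq_dyadQuadratic hd hII hp3
  refine ⟨contMDiff_pi_space.2 fun A ↦ contMDiff_pi_space.2 fun B ↦ ?_, fun x A B ↦ ?_,
    hE.divergence_spinLowering hd hII hp hp3⟩
  · rw [funext fun x ↦ hφ x A B]
    refine isSmooth_dyadQuadratic (isSmooth_lower hd.1 0) (isSmooth_lower hd.1 1)
      (isSmooth_lower hd.2.1 0) (isSmooth_lower hd.2.1 1) (hp.fmul hp)
      ((isSmooth_const _).fmul ((IsSmooth.finv hp fun y h ↦ hII.2 y ?_).fmul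
        (hE.isSmooth_Psi hd).1)) _
    rw [← hp3, h]
    ring
  · rw [hφ, hφ, add_comm (A : ℕ)]

end Dyad

end SpinFrame
end SpinGeometry
end

theorem typeII_spin_lowering_maxwell {M : Type*} [TopologicalSpace M]
    [ChartedSpace SpinGeometry.E4 M] [IsManifold (𝓡 4) ∞ M]
    (g : SpinGeometry.LorentzMetric M) (F : SpinGeometry.SpinFrame g)
    (hEinstein : F.IsEinstein)
    (o ι : M → Fin 2 → ℂ) (hdyad : SpinGeometry.IsSpinDyad o ι)
    (hII : F.IsPetrovTypeII o ι)
    -- a smooth choice of the cube root of `Ψ₂`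
    (p : M → ℂ) (hp : ContMDiff (𝓡 4) 𝓘(ℝ, ℂ) ∞ p) (hp3 : ∀ x, p x ^ 3 = F.Psi2 o ι x) :
    (∀ x A B, F.spinLowering (F.projectedKillingSpinor o ι p) x A B =
      -2 * F.Psi2 o ι x * F.projectedKillingSpinor o ι p x A B) ∧
    F.IsMaxwellField (F.spinLowering (F.projectedKillingSpinor o ι p)) := by
  obtain ⟨Λ, hE⟩ := hEinstein.exists_einsteinWith
  exact ⟨hE.spinLowering_eq hdyad hII hp3, hE.isMaxwellField_spinLowering hdyad hII hp hp3⟩
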